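/- The multivariable Wilson polynomials satisfy the orthogonality relation ∫_{−∞}^{∞} ⋯ ∫_{−∞}^{∞} W_n(x) W_m(x) ρ(x) dx_1 ⋯ dx_s = λ_n δ_{n,m}, where λ_n = (4π)^s [∏_{k=1}^{s} n_k! (N_k + N_{k−1} + 2α_{k+1} − 1)_{n_k} Γ(N_k + N_{k−1} + 2α_k) Γ(n_k + 2a_{k+1}) / Γ(2N_k + 2α_{k+1})] · Γ(a+c+α_{2,s}+N_s) Γ(a+d+α_{2,s}+N_s) Γ(b+c+α_{2,s}+N_s) Γ(b+d+α_{2,s}+N_s), and in the product W_n W_m the second factor uses the multi-index m with its own partial sums M_k = ∑_{i=1}^{k} m_i in place of N_k. -/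

import Mathlib

open MeasureTheory Classical Complex

noncomputable section

/-- The shifted factorial `(z)_n = z (z+1) ⋯ (z+n-1)`. -/
def pochC (z : ℂ) (n : ℕ) : ℂ := ∏ j ∈ Finset.range n, (z + j)

/-- The Wilson polynomial `w_n(x; a,b,c,d)` of (1.1). -/
def wilsonP (a b c d : ℂ) (n : ℕ) (x : ℝ) : ℂ :=
  pochC (a + b) n * pochC (a + c) n * pochC (a + d) n *
    ∑ k ∈ Finset.range (n + 1),
      pochC (-(n : ℂ)) k * pochC ((n : ℂ) + a + b + c + d - 1) k *
        pochC (a + Complex.I * x) k * pochC (a - Complex.I * x) k /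
      ((k.factorial : ℂ) * pochC (a + b) k * pochC (a + c) k * pochC (a + d) k)

/-- Partial sum `N_{j,k} = n_j + ⋯ + n_k` (empty sum = 0). -/
def psum (n : ℕ → ℕ) (j k : ℕ) : ℕ := ∑ i ∈ Finset.Icc j k, n i

/-- The extended parameter list: `a_1 = (a+b)/2`, `a_{s+1} = (c+d)/2`, and `a_k = ap k`
for `2 ≤ k ≤ s`. -/
def apEx (a b c d : ℂ) (ap : ℕ → ℂ) (s k : ℕ) : ℂ :=
  if k = 1 then (a + b) / 2 else if k = s + 1 then (c + d) / 2 else ap k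

/-- `α_{j,k} = a_j + ⋯ + a_k` (empty sum = 0), using the extended parameter list. -/
def alphaS (a b c d : ℂ) (ap : ℕ → ℂ) (s j k : ℕ) : ℂ :=
  ∑ i ∈ Finset.Icc j k, apEx a b c d ap s i

/-- The weight function `ρ(x)` of (1.5), with one-based variables `x 1, …, x s`. -/
def wilsonRho (a b c d : ℂ) (ap : ℕ → ℂ) (s : ℕ) (x : ℕ → ℝ) : ℂ :=
  Complex.Gamma (a + Complex.I * x 1) * Complex.Gamma (a - Complex.I * x 1) *
      Complex.Gamma (b + Complex.I * x 1) * Complex.Gamma (b - Complex.I * x 1) *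
    (∏ k ∈ Finset.Icc 1 (s - 1),
      Complex.Gamma (ap (k + 1) + Complex.I * x (k + 1) + Complex.I * x k) *
          Complex.Gamma (ap (k + 1) - Complex.I * x (k + 1) - Complex.I * x k) *
          Complex.Gamma (ap (k + 1) + Complex.I * x (k + 1) - Complex.I * x k) *
          Complex.Gamma (ap (k + 1) - Complex.I * x (k + 1) + Complex.I * x k) /
        (Complex.Gamma (2 * Complex.I * x k) * Complex.Gamma (-(2 * Complex.I * x k)))) *
    (Complex.Gamma (c + Complex.I * x s) * Complex.Gamma (c - Complex.I * x s) *
        Complex.Gamma (d + Complex.I * x s) * Complex.Gamma (d - Complex.I * x s) /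
      (Complex.Gamma (2 * Complex.I * x s) * Complex.Gamma (-(2 * Complex.I * x s))))

/-- One-based list of variables `x_1,…,x_s` obtained from a point `y ∈ ℝ^s`. -/
def lift (s : ℕ) (y : Fin s → ℝ) (k : ℕ) : ℝ := if h : k - 1 < s then y ⟨k - 1, h⟩ else 0

/-- The multivariable Wilson polynomial `W_n(x)` of (1.2). -/
def mvWilson (a b c d : ℂ) (ap : ℕ → ℂ) (s : ℕ) (n : ℕ → ℕ) (x : ℕ → ℝ) : ℂ :=
  (∏ k ∈ Finset.Icc 1 (s - 1),
      wilsonP (a + alphaS a b c d ap s 2 k + psum n 1 (k - 1))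
        (b + alphaS a b c d ap s 2 k + psum n 1 (k - 1))
        (ap (k + 1) + Complex.I * x (k + 1)) (ap (k + 1) - Complex.I * x (k + 1))
        (n k) (x k)) *
    wilsonP (a + alphaS a b c d ap s 2 s + psum n 1 (s - 1))
      (b + alphaS a b c d ap s 2 s + psum n 1 (s - 1)) c d (n s) (x s)

/-- The normalization constant `λ_n` of (1.6). -/
def lamW (a b c d : ℂ) (ap : ℕ → ℂ) (s : ℕ) (n : ℕ → ℕ) : ℂ :=
  ((4 * Real.pi : ℝ) : ℂ) ^ s *
    (∏ k ∈ Finset.Icc 1 s,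
      (Nat.factorial (n k) : ℂ) *
          pochC ((psum n 1 k : ℂ) + psum n 1 (k - 1) + 2 * alphaS a b c d ap s 1 (k + 1) - 1)
            (n k) *
          Complex.Gamma ((psum n 1 k : ℂ) + psum n 1 (k - 1) + 2 * alphaS a b c d ap s 1 k) *
          Complex.Gamma ((n k : ℂ) + 2 * apEx a b c d ap s (k + 1)) /
        Complex.Gamma (2 * (psum n 1 k : ℂ) + 2 * alphaS a b c d ap s 1 (k + 1))) *
    (Complex.Gamma (a + c + alphaS a b c d ap s 2 s + psum n 1 s) *
      Complex.Gamma (a + d + alphaS a b c d ap s 2 s + psum n 1 s) *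
      Complex.Gamma (b + c + alphaS a b c d ap s 2 s + psum n 1 s) *
      Complex.Gamma (b + d + alphaS a b c d ap s 2 s + psum n 1 s))

section part1
open MeasureTheory Classical Complex

lemma norm_Gamma_mul_le {σ M t : ℝ} (h0 : 0 < σ) (hM : σ ≤ M) :
    ‖Complex.Gamma (σ + t * I)‖ * Real.Gamma M ≤ ‖Complex.Gamma (M + t * I)‖ * Real.Gamma σ := by
  have h1 := ((Complex.GammaSeq_tendsto_Gamma (σ + t * I)).norm).mul (Real.GammaSeq_tendsto_Gamma M)
  have h2 := ((Complex.GammaSeq_tendsto_Gamma (M + t * I)).norm).mul (Real.GammaSeq_tendsto_Gamma σ)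
  refine le_of_tendsto_of_tendsto h1 h2 ?_
  filter_upwards [Filter.eventually_gt_atTop 0] with n hn
  have hM0 : 0 < M := lt_of_lt_of_le h0 hM
  have key : ∀ s : ℝ, 0 < s → ∀ r : ℝ, 0 < r → ‖Complex.GammaSeq (s + t * I) n‖ * Real.GammaSeq r n =
      ((n:ℝ) ^ s * n.factorial * ((n:ℝ) ^ r * n.factorial)) /
      (∏ j ∈ Finset.range (n+1), (‖(s + t * I + j : ℂ)‖ * (r + j))) := by
    intro s hs r hr
    unfold Complex.GammaSeq Real.GammaSeq
    rw [norm_div, norm_mul, Complex.norm_natCast_cpow_of_pos hn, norm_prod, Finset.prod_mul_distrib]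
    simp
    rw [div_mul_div_comm]
  rw [key σ h0 M hM0, key M hM0 σ h0]
  rw [mul_comm ((n:ℝ) ^ σ * n.factorial)]
  have hpos : ∀ s : ℝ, 0 < s → ∀ j : ℕ, 0 < ‖(s + t * I + j : ℂ)‖ := by
    intro s hs j
    rw [norm_pos_iff]
    intro h
    have := congrArg Complex.re h
    simp at this
    have : (0:ℝ) ≤ j := Nat.cast_nonneg j
    linarith
  apply div_le_div_of_nonneg_left
  · positivity
  · apply Finset.prod_pos
    intro j _
    have := hpos M hM0 j
    positivity
  · apply Finset.prod_le_prod
    · intro j _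
      have := hpos M hM0 j
      positivity
    · intro j _
      have hj : (0:ℝ) ≤ j := Nat.cast_nonneg j
      have e : ∀ s : ℝ, ‖(s + t * I + j : ℂ)‖ ^ 2 = (s + j)^2 + t^2 := by
        intro s
        rw [← Complex.normSq_eq_norm_sq, Complex.normSq_apply]
        simp
        ring
      apply le_of_sq_le_sq _ (by positivity)
      rw [mul_pow, mul_pow, e, e]
      have : (σ + j)^2 ≤ (M + j)^2 := by gcongr
      nlinarith [sq_nonneg t]
where
  le_of_sq_le_sq {a b : ℝ} (h : a^2 ≤ b^2) (hb : 0 ≤ b) : a ≤ b := (le_abs_self a).trans (abs_le_of_sq_le_sq h hb)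

lemma norm_Gamma_le_re {z : ℂ} (h : 0 < z.re) : ‖Complex.Gamma z‖ ≤ Real.Gamma z.re := by
  have h1 := ((Complex.GammaSeq_tendsto_Gamma z).norm)
  have h2 := (Real.GammaSeq_tendsto_Gamma z.re)
  refine le_of_tendsto_of_tendsto h1 h2 ?_
  filter_upwards [Filter.eventually_gt_atTop 0] with n hn
  unfold Complex.GammaSeq Real.GammaSeq
  rw [norm_div, norm_mul, Complex.norm_natCast_cpow_of_pos hn, norm_prod]
  simp only [Complex.norm_natCast]
  apply div_le_div_of_nonneg_left
  · positivity
  · apply Finset.prod_pos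
    intro j _
    positivity
  · apply Finset.prod_le_prod
    · intro j _
      positivity
    · intro j _
      have := Complex.re_le_norm (z + j)
      simpa using this

lemma norm_Gamma_half (t : ℝ) : ‖Complex.Gamma ((1/2 : ℝ) + t * I)‖ ^ 2 = Real.pi / Real.cosh (Real.pi * t) := by
  have h := Complex.Gamma_mul_Gamma_one_sub ((1/2 : ℝ) + t * I)
  have e : (1 - (((1/2 : ℝ):ℂ) + t * I)) = (starRingEnd ℂ) (((1/2 : ℝ):ℂ) + t * I) := by
    simp only [map_add, map_mul, Complex.conj_ofReal, Complex.conj_I]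
    push_cast; ring
  rw [e, Complex.Gamma_conj, Complex.mul_conj, Complex.normSq_eq_norm_sq] at h
  have e2 : Complex.sin (Real.pi * (((1/2 : ℝ):ℂ) + t * I)) = ((Real.cosh (Real.pi * t) : ℝ) : ℂ) := by
    have : (Real.pi * (((1/2 : ℝ):ℂ) + t * I)) = ((Real.pi * t : ℝ) : ℂ) * I + Real.pi / 2 := by
      push_cast; ring
    rw [this, Complex.sin_add_pi_div_two, Complex.cos_mul_I, Complex.ofReal_cosh]
  rw [e2] at h
  exact_mod_cast h

lemma norm_Gamma_half_le (t : ℝ) : ‖Complex.Gamma ((1/2 : ℝ) + t * I)‖ ≤ 3 * Real.exp (-(Real.pi/2) * |t|) := by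
  have h := norm_Gamma_half t
  have hc : Real.exp (Real.pi * |t|) / 2 ≤ Real.cosh (Real.pi * t) := by
    rw [← Real.cosh_abs (Real.pi * t), abs_mul, abs_of_pos Real.pi_pos, Real.cosh_eq]
    have := Real.exp_pos (-(Real.pi * |t|))
    linarith
  refine (le_abs_self _).trans (abs_le_of_sq_le_sq ?_ (by positivity))
  rw [h, mul_pow, ← Real.exp_nat_mul]
  calc Real.pi / Real.cosh (Real.pi * t) ≤ Real.pi / (Real.exp (Real.pi * |t|) / 2) := by
        gcongr
    _ = 2 * Real.pi * Real.exp (-(Real.pi * |t|)) := by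
        rw [Real.exp_neg]; field_simp
    _ ≤ _ := by
        have : Real.exp (↑2 * (-(Real.pi / 2) * |t|)) = Real.exp (-(Real.pi * |t|)) := by
          congr 1; ring
        push_cast
        rw [this]
        gcongr
        nlinarith [Real.pi_lt_four]

/-- subexponential growth relative to a gauge -/
def SubExp {X : Type*} (g : X → ℝ) (f : X → ℂ) : Prop :=
  ∀ ε > 0, ∃ C : ℝ, 0 ≤ C ∧ ∀ x, ‖f x‖ ≤ C * Real.exp (ε * g x)

namespace SubExp
variable {X : Type*} {g : X → ℝ} {f f' : X → ℂ}

lemma mul (h : SubExp g f) (h' : SubExp g f') : SubExp g (fun x => f x * f' x) := by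
  intro ε hε
  obtain ⟨C, hC, h1⟩ := h (ε/2) (by positivity)
  obtain ⟨C', hC', h2⟩ := h' (ε/2) (by positivity)
  refine ⟨C * C', by positivity, fun x => ?_⟩
  rw [norm_mul]
  calc _ ≤ (C * Real.exp (ε/2 * g x)) * (C' * Real.exp (ε/2 * g x)) := by
        gcongr
        · exact h1 x
        · exact h2 x
    _ = _ := by
        have : Real.exp (ε * g x) = Real.exp (ε/2 * g x) * Real.exp (ε/2 * g x) := by
          rw [← Real.exp_add]; congr 1; ring
        rw [this]; ring

lemma add (h : SubExp g f) (h' : SubExp g f') : SubExp g (fun x => f x + f' x) := by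
  intro ε hε
  obtain ⟨C, hC, h1⟩ := h ε hε
  obtain ⟨C', hC', h2⟩ := h' ε hε
  refine ⟨C + C', by positivity, fun x => ?_⟩
  calc _ ≤ ‖f x‖ + ‖f' x‖ := norm_add_le _ _
    _ ≤ _ := by rw [add_mul]; exact add_le_add (h1 x) (h2 x)

lemma of_bounded (hg : ∀ x, 0 ≤ g x) {C : ℝ} (h : ∀ x, ‖f x‖ ≤ C) : SubExp g f := by
  intro ε hε
  refine ⟨|C|, abs_nonneg _, fun x => (h x).trans ((le_abs_self C).trans ?_)⟩
  have : 1 ≤ Real.exp (ε * g x) := Real.one_le_exp (mul_nonneg hε.le (hg x))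
  exact le_mul_of_one_le_right (abs_nonneg _) this

lemma of_linear (hg : ∀ x, 0 ≤ g x) {C D : ℝ} (h : ∀ x, ‖f x‖ ≤ C + D * g x) : SubExp g f := by
  intro ε hε
  refine ⟨|C| + |D| / ε, by positivity, fun x => (h x).trans ?_⟩
  have h1 : 1 ≤ Real.exp (ε * g x) := Real.one_le_exp (mul_nonneg hε.le (hg x))
  have h2 : ε * g x ≤ Real.exp (ε * g x) := by
    have := Real.add_one_le_exp (ε * g x); linarith
  have h3 : C ≤ |C| * Real.exp (ε * g x) := (le_abs_self C).trans (le_mul_of_one_le_right (abs_nonneg _) h1)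
  have h4 : D * g x ≤ |D| / ε * Real.exp (ε * g x) := by
    calc D * g x ≤ |D| * g x := mul_le_mul_of_nonneg_right (le_abs_self D) (hg x)
      _ = |D| / ε * (ε * g x) := by field_simp
      _ ≤ _ := by gcongr
  rw [add_mul]; exact add_le_add h3 h4

lemma prod {ι : Type*} (s : Finset ι) (hg : ∀ x, 0 ≤ g x) {F : ι → X → ℂ} (h : ∀ i ∈ s, SubExp g (F i)) :
    SubExp g (fun x => ∏ i ∈ s, F i x) := by
  induction s using Finset.induction_on with
  | empty => simpa using of_bounded (f := fun _ => (1:ℂ)) hg (C := 1) (by simp)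
  | insert a s ha ih =>
    simp only [Finset.prod_insert ha]
    exact (h a (by simp)).mul (ih fun i hi => h i (by simp [hi]))

lemma sum {ι : Type*} (s : Finset ι) (hg : ∀ x, 0 ≤ g x) {F : ι → X → ℂ} (h : ∀ i ∈ s, SubExp g (F i)) :
    SubExp g (fun x => ∑ i ∈ s, F i x) := by
  induction s using Finset.induction_on with
  | empty => simpa using of_bounded (f := fun _ => (0:ℂ)) hg (C := 0) (by simp)
  | insert a s ha ih =>
    simp only [Finset.sum_insert ha]
    exact (h a (by simp)).add (ih fun i hi => h i (by simp [hi]))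

lemma comp {Y : Type*} (h : SubExp g f) (φ : Y → X) : SubExp (fun y => g (φ y)) (fun y => f (φ y)) := by
  intro ε hε
  obtain ⟨C, hC, h1⟩ := h ε hε
  exact ⟨C, hC, fun y => h1 _⟩

lemma mono (h : SubExp g f) {g' : X → ℝ} {A B : ℝ} (hB : 0 ≤ B) (hgg : ∀ x, g x ≤ A + B * g' x)
    (hg' : ∀ x, 0 ≤ g' x) : SubExp g' f := by
  intro ε hε
  obtain ⟨C, hC, h1⟩ := h (ε / (B + 1)) (by positivity)
  refine ⟨C * Real.exp (ε / (B+1) * A), by positivity, fun x => (h1 x).trans ?_⟩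
  rw [mul_assoc, ← Real.exp_add]
  gcongr
  calc ε / (B+1) * g x ≤ ε / (B+1) * (A + B * g' x) := by gcongr; exact hgg x
    _ = ε / (B+1) * A + ε * g' x * (B / (B+1)) := by ring
    _ ≤ ε / (B+1) * A + ε * g' x * 1 := by
      have := hg' x
      gcongr
      rw [div_le_one (by positivity)]; linarith
    _ = _ := by ring

lemma of_norm_le (h : SubExp g f) (hh : ∀ x, ‖f' x‖ ≤ ‖f x‖) : SubExp g f' := by
  intro ε hε
  obtain ⟨C, hC, h1⟩ := h ε hε
  exact ⟨C, hC, fun y => (hh y).trans (h1 _)⟩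
end SubExp

/-- Gamma with its exponential decay removed is subexponential in vertical strips. -/
lemma gamma_subexp {σ0 σ1 : ℝ} (h0 : 0 < σ0) :
    SubExp (X := {z : ℂ // σ0 ≤ z.re ∧ z.re ≤ σ1}) (fun z => |z.1.im|)
      (fun z => Complex.Gamma z.1 * (Real.exp (Real.pi / 2 * |z.1.im|) : ℝ)) := by
  obtain ⟨N, hN⟩ := exists_nat_ge σ1
  set M : ℝ := 1/2 + N with hMdef
  have hM0 : 0 < M := by positivity
  have hgn : ∀ z : {z : ℂ // σ0 ≤ z.re ∧ z.re ≤ σ1}, 0 ≤ |z.1.im| := fun z => abs_nonneg _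
  -- bounds of real Gamma
  obtain ⟨B, hB⟩ : ∃ B, ∀ σ ∈ Set.Icc σ0 M, ‖Real.Gamma σ‖ ≤ B := by
    apply IsCompact.exists_bound_of_continuousOn isCompact_Icc
    intro σ hσ
    refine (Real.differentiableAt_Gamma ?_).continuousAt.continuousWithinAt
    intro m hm
    have : (0:ℝ) ≤ m := Nat.cast_nonneg m
    have := hσ.1
    linarith
  have hrec : ∀ (k : ℕ) (t : ℝ), Complex.Gamma ((1/2 + k : ℝ) + t * I) =
      (∏ j ∈ Finset.range k, ((1/2 + j : ℝ) + t * I : ℂ)) * Complex.Gamma ((1/2 : ℝ) + t * I) := by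
    intro k t
    induction k with
    | zero => simp
    | succ k ih =>
      rw [Finset.prod_range_succ]
      have : (((1/2 + (k+1 : ℕ) : ℝ) : ℂ) + t * I) = (((1/2 + k : ℝ):ℂ) + t * I) + 1 := by push_cast; ring
      rw [this, Complex.Gamma_add_one, ih]
      · ring
      · intro h
        have := congrArg Complex.re h
        simp at this
        have : (0:ℝ) ≤ k := Nat.cast_nonneg k
        linarith
  have hP : SubExp (X := {z : ℂ // σ0 ≤ z.re ∧ z.re ≤ σ1}) (fun z => |z.1.im|)
      (fun z => ((3 * B / Real.Gamma M : ℝ) : ℂ) * ∏ j ∈ Finset.range N, (((1/2 + j : ℝ):ℂ) + z.1.im * I : ℂ)) := by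
    apply SubExp.mul
    · exact SubExp.of_bounded hgn (C := ‖((3 * B / Real.Gamma M : ℝ) : ℂ)‖) (fun _ => le_rfl)
    · apply SubExp.prod _ hgn
      intro j _
      apply SubExp.of_linear hgn (C := ‖((1/2 + j : ℝ):ℂ)‖) (D := 1)
      intro x
      refine (norm_add_le _ _).trans ?_
      simp
  refine hP.of_norm_le ?_
  rintro ⟨z, hz0, hz1⟩
  dsimp only
  have hzp : 0 < z.re := h0.trans_le hz0
  have hzM : z.re ≤ M := by rw [hMdef]; linarith
  have hG : 0 < Real.Gamma M := Real.Gamma_pos_of_pos hM0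
  have h1 := norm_Gamma_mul_le (t := z.im) hzp hzM
  rw [Complex.re_add_im, hMdef, hrec N, ← hMdef, norm_mul] at h1
  have h2 := norm_Gamma_half_le z.im
  have h3 : Real.Gamma z.re ≤ B := (le_abs_self _).trans (hB _ ⟨hz0, hzM⟩)
  have hB0 : 0 ≤ B := (Real.Gamma_pos_of_pos hzp).le.trans h3
  rw [norm_mul, norm_mul, Complex.norm_real, Complex.norm_real, Real.norm_of_nonneg (Real.exp_pos _).le,
    Real.norm_of_nonneg (by positivity)]
  set P := ‖∏ j ∈ Finset.range N, (((1/2 + j : ℝ):ℂ) + z.im * I : ℂ)‖ with hPdef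
  have hP0 : 0 ≤ P := norm_nonneg _
  have h4 : ‖Complex.Gamma z‖ * Real.Gamma M ≤ P * (3 * Real.exp (-(Real.pi / 2) * |z.im|)) * B := by
    refine h1.trans ?_
    gcongr
  have h5 : ‖Complex.Gamma z‖ ≤ P * (3 * Real.exp (-(Real.pi / 2) * |z.im|)) * B / Real.Gamma M := by
    rwa [le_div_iff₀ hG]
  calc ‖Complex.Gamma z‖ * Real.exp (Real.pi / 2 * |z.im|)
      ≤ (P * (3 * Real.exp (-(Real.pi / 2) * |z.im|)) * B / Real.Gamma M) * Real.exp (Real.pi / 2 * |z.im|) := by gcongr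
    _ = 3 * B / Real.Gamma M * P * (Real.exp (-(Real.pi / 2) * |z.im|) * Real.exp (Real.pi / 2 * |z.im|)) := by ring
    _ = _ := by rw [← Real.exp_add]; simp
end part1

section part2
open MeasureTheory Classical Complex

lemma measurable_Gamma : Measurable Complex.Gamma := by
  have h : Measurable (fun s : ℂ => ((Complex.Gamma s)⁻¹)⁻¹) :=
    (Complex.differentiable_one_div_Gamma.continuous.measurable).inv
  simpa using h

lemma norm_csin_le (w : ℂ) : ‖Complex.sin w‖ ≤ Real.exp |w.im| := by
  have h1 : ‖Complex.exp (-w * I)‖ ≤ Real.exp |w.im| := by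
    rw [Complex.norm_exp]; simp; exact le_abs_self _
  have h2 : ‖Complex.exp (w * I)‖ ≤ Real.exp |w.im| := by
    rw [Complex.norm_exp]; simp; exact neg_le_abs _
  unfold Complex.sin
  rw [norm_div, norm_mul, Complex.norm_I, mul_one]
  have h3 := norm_sub_le (Complex.exp (-w * I)) (Complex.exp (w * I))
  simp only [Complex.norm_ofNat]
  linarith

lemma integrable_exp_neg_abs {c : ℝ} (hc : 0 < c) : Integrable (fun t : ℝ => Real.exp (-c * |t|)) := by
  have h1 : IntegrableOn (fun t : ℝ => Real.exp (-c * |t|)) (Set.Ioi 0) := by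
    refine (integrableOn_exp_mul_Ioi (a := -c) (by linarith) 0).congr_fun ?_ measurableSet_Ioi
    intro t ht
    simp only [abs_of_pos (Set.mem_Ioi.1 ht)]
  have h2 : IntegrableOn (fun t : ℝ => Real.exp (-c * |t|)) (Set.Iic 0) := by
    refine (integrableOn_exp_mul_Iic (a := c) hc 0).congr_fun ?_ measurableSet_Iic
    intro t ht
    simp only [abs_of_nonpos (Set.mem_Iic.1 ht)]
    ring_nf
  rw [← integrableOn_univ, ← Set.Iic_union_Ioi (a := (0:ℝ))]
  exact h2.union h1

lemma integrable_of_exp_bound {f : ℝ → ℂ} (hm : Measurable f) {C c : ℝ} (hc : 0 < c)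
    (h : ∀ t, ‖f t‖ ≤ C * Real.exp (-c * |t|)) : Integrable f :=
  Integrable.mono' ((integrable_exp_neg_abs hc).const_mul C) hm.aestronglyMeasurable
    (Filter.Eventually.of_forall h)

lemma contour_shift {F : ℂ → ℂ} (hm : Measurable F)
    (hd : ∀ z : ℂ, |z.re| ≤ 1/2 → DifferentiableAt ℂ F z) {C : ℝ}
    (hb : ∀ z : ℂ, |z.re| ≤ 1/2 → ‖F z‖ ≤ C * Real.exp (- |z.im|)) :
    ∫ t : ℝ, (F (1/2 + I * t) - F (-1/2 + I * t)) = 0 := by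
  have hC : 0 ≤ C := by
    have h1 := (norm_nonneg _).trans (hb 0 (by simp))
    simpa using h1
  have hi : ∀ σ : ℝ, |σ| ≤ 1/2 → Integrable (fun t : ℝ => F (σ + t * I)) := by
    intro σ hσ
    refine integrable_of_exp_bound (C := C) (c := 1) (hm.comp (by fun_prop)) one_pos ?_
    intro t
    have := hb (σ + t * I) (by simpa using hσ)
    simpa using this
  have hi1 := hi (1/2) (by rw [abs_of_pos] <;> norm_num)
  have hi2 := hi (-1/2) (by rw [abs_le]; constructor <;> norm_num)
  have hlim : ∀ σ : ℝ, |σ| ≤ 1/2 → Filter.Tendsto (fun T : ℝ => ∫ t in (-T)..T, F (σ + t * I)) Filter.atTop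
      (nhds (∫ t : ℝ, F (σ + t * I))) := fun σ hσ =>
    intervalIntegral_tendsto_integral (hi σ hσ) Filter.tendsto_neg_atTop_atBot Filter.tendsto_id
  have hL1 := hlim (1/2) (by rw [abs_of_pos] <;> norm_num)
  have hL2 := hlim (-1/2) (by rw [abs_le]; constructor <;> norm_num)
  have hsub := hL1.sub hL2
  have hexp : Filter.Tendsto (fun T : ℝ => 2 * C * Real.exp (-T)) Filter.atTop (nhds 0) := by
    have := (Real.tendsto_exp_neg_atTop_nhds_zero).const_mul (2 * C)
    simpa using this
  have hzero : Filter.Tendsto (fun T : ℝ => (∫ t in (-T)..T, F ((1/2:ℝ) + t * I)) -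
      ∫ t in (-T)..T, F ((-1/2:ℝ) + t * I)) Filter.atTop (nhds 0) := by
    refine squeeze_zero_norm' ?_ hexp
    filter_upwards [Filter.eventually_ge_atTop 0] with T hT
    have hrect := Complex.integral_boundary_rect_eq_zero_of_differentiableOn F
      (⟨-1/2, -T⟩ : ℂ) (⟨1/2, T⟩ : ℂ) (by
        intro z hz
        refine (hd z ?_).differentiableWithinAt
        have := hz.1
        simp only [Set.mem_preimage] at this
        rw [Set.uIcc_of_le (by norm_num)] at this
        rw [abs_le]
        constructor
        · have := this.1; linarith
        · have := this.2; linarith)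
    simp only [smul_eq_mul] at hrect
    have hbnd : ∀ y : ℝ, |y| = T → ‖∫ x in (-1/2:ℝ)..(1/2), F (x + y * I)‖ ≤ C * Real.exp (-T) := by
      intro y hy
      have := intervalIntegral.norm_integral_le_of_norm_le_const (a := (-1/2:ℝ)) (b := 1/2)
        (f := fun x : ℝ => F (x + y * I)) (C := C * Real.exp (-T)) (by
          intro x hx
          rw [Set.uIoc_of_le (by norm_num)] at hx
          have := hb (x + y * I) (by
            simp [abs_le]; constructor
            · have := hx.1; linarith
            · have := hx.2; linarith)
          simpa [hy] using this)
      refine this.trans (le_of_eq ?_)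
      norm_num
    have b1 := hbnd (-T) (by rw [abs_neg, abs_of_nonneg hT])
    have b2 := hbnd T (abs_of_nonneg hT)
    have heq : (∫ t in (-T)..T, F ((1/2:ℝ) + t * I)) - ∫ t in (-T)..T, F ((-1/2:ℝ) + t * I) =
        I * ((∫ x in (-1/2:ℝ)..(1/2), F (x + (-T : ℝ) * I)) - ∫ x in (-1/2:ℝ)..(1/2), F (x + T * I)) := by
      have hI : I * I = -1 := Complex.I_mul_I
      linear_combination (-I) * hrect + ((∫ t in (-T)..T, F ((1/2:ℝ) + t * I)) - ∫ t in (-T)..T, F ((-1/2:ℝ) + t * I)) * hI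
    rw [heq, norm_mul, Complex.norm_I, one_mul]
    refine (norm_sub_le _ _).trans ?_
    linarith
  have h := tendsto_nhds_unique hsub hzero
  rw [← integral_sub hi1 hi2] at h
  rw [← h]
  congr 1
  ext t
  push_cast
  simp only [mul_comm I]

def gp (a : ℂ) (x : ℝ) : ℂ := Complex.Gamma (a + I * x) * Complex.Gamma (a - I * x)

def Vw (x : ℝ) : ℂ := (Complex.Gamma (2 * I * x) * Complex.Gamma (-(2 * I * x)))⁻¹

lemma Vw_eq (x : ℝ) : Vw x = ((2 * x * Real.sinh (2 * Real.pi * x) / Real.pi : ℝ) : ℂ) := by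
  by_cases hx : x = 0
  · simp [hx, Vw]
  have hx' : (2 * I * x : ℂ) ≠ 0 := by simp [hx]
  have h := Complex.Gamma_mul_Gamma_one_sub (2 * I * x)
  have e : (1 - 2 * I * x : ℂ) = -(2 * I * x) + 1 := by ring
  rw [e, Complex.Gamma_add_one _ (neg_ne_zero.2 hx')] at h
  have e2 : Complex.sin (Real.pi * (2 * I * x)) = Real.sinh (2 * Real.pi * x) * I := by
    rw [Complex.ofReal_sinh, ← Complex.sin_mul_I]; congr 1; push_cast; ring
  rw [e2] at h
  have hs : ((Real.sinh (2 * Real.pi * x) : ℝ) : ℂ) ≠ 0 := by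
    rw [Complex.ofReal_ne_zero]
    rw [Real.sinh_ne_zero]
    have := Real.pi_ne_zero
    positivity
  have hp : (Real.pi : ℂ) ≠ 0 := Complex.ofReal_ne_zero.2 Real.pi_ne_zero
  have hI := Complex.I_ne_zero
  have hxc : (x:ℂ) ≠ 0 := by exact_mod_cast hx
  have h2 : Complex.Gamma (2 * I * x) * Complex.Gamma (-(2 * I * x)) =
      Real.pi / (2 * x * Real.sinh (2 * Real.pi * x)) := by
    rw [eq_div_iff (by simp [hx]; simpa using hs)]
    rw [eq_div_iff (by simp; simpa using hs)] at h
    have hI : I * I = -1 := Complex.I_mul_I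
    linear_combination h + 2 * x * Real.sinh (2 * Real.pi * x) * Complex.Gamma (2 * I * x) * Complex.Gamma (-(2 * I * x)) * hI
  unfold Vw
  rw [h2]
  push_cast
  rw [inv_div]

lemma gamma_line {α : ℂ} (hα : 0 < α.re) :
    SubExp (fun t : ℝ => |t|) (fun t : ℝ => Complex.Gamma (α + I * t) * (Real.exp (Real.pi / 2 * |t|) : ℝ)) := by
  have h := gamma_subexp (σ0 := α.re) (σ1 := α.re) hα
  have h1 := h.comp (fun t : ℝ => (⟨α + I * t, by simp, by simp⟩ : {z : ℂ // α.re ≤ z.re ∧ z.re ≤ α.re}))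
  have h2 : SubExp (fun t : ℝ => |t|) _ := h1.mono (g' := fun t : ℝ => |t|) (A := |α.im|) (B := 1) zero_le_one
    (fun t => by simpa using abs_add_le α.im t) (fun t => abs_nonneg t)
  have h3 := (SubExp.of_bounded (g := fun t : ℝ => |t|) (f := fun t => ((Real.exp (Real.pi / 2 * |α.im|) : ℝ) : ℂ))
    (fun t => abs_nonneg t) (C := _) (fun _ => le_rfl)).mul h2
  refine h3.of_norm_le ?_
  intro t
  simp only [norm_mul, Complex.norm_real, Real.norm_of_nonneg (Real.exp_pos _).le]
  have : Real.exp (Real.pi / 2 * |t|) ≤ Real.exp (Real.pi / 2 * |α.im|) * Real.exp (Real.pi / 2 * |(α + I * t).im|) := by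
    rw [← Real.exp_add, ← mul_add]
    gcongr
    have := abs_sub (α.im + t) α.im
    simp at this ⊢
    linarith
  calc _ ≤ ‖Complex.Gamma (α + I * t)‖ * (Real.exp (Real.pi / 2 * |α.im|) * Real.exp (Real.pi / 2 * |(α + I * t).im|)) := by gcongr
    _ = _ := by ring

lemma gp_line {α : ℂ} (hα : 0 < α.re) :
    SubExp (fun t : ℝ => |t|) (fun t : ℝ => gp α t * (Real.exp (Real.pi * |t|) : ℝ)) := by
  have h1 := gamma_line hα
  have h2 := h1.comp (fun t : ℝ => -t)
  simp only [abs_neg] at h2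
  refine (h1.mul h2).of_norm_le ?_
  intro t
  apply le_of_eq
  congr 1
  unfold gp
  have : Real.exp (Real.pi * |t|) = Real.exp (Real.pi / 2 * |t|) * Real.exp (Real.pi / 2 * |t|) := by
    rw [← Real.exp_add]; congr 1; ring
  rw [this]
  push_cast
  rw [mul_neg, ← sub_eq_add_neg]
  ring

lemma Vw_line : SubExp (fun t : ℝ => |t|) (fun t : ℝ => Vw t * (Real.exp (-(2 * Real.pi) * |t|) : ℝ)) := by
  apply SubExp.of_linear (fun t => abs_nonneg t) (C := 0) (D := 2)
  intro t
  rw [Vw_eq, ← Complex.ofReal_mul, Complex.norm_real, Real.norm_eq_abs, abs_mul, abs_div, abs_mul, abs_mul,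
    abs_of_pos Real.pi_pos, abs_of_pos (Real.exp_pos _), abs_two]
  have h1 : |Real.sinh (2 * Real.pi * t)| ≤ Real.exp (2 * Real.pi * |t|) := by
    rw [Real.abs_sinh, abs_mul, abs_of_pos (by positivity : 0 < 2 * Real.pi), Real.sinh_eq]
    have := Real.exp_pos (2 * Real.pi * |t|)
    have := Real.exp_pos (-(2 * Real.pi * |t|))
    linarith
  have h2 : Real.exp (2 * Real.pi * |t|) * Real.exp (-(2 * Real.pi) * |t|) = 1 := by
    rw [← Real.exp_add]; simp
  have h3 : 1 ≤ Real.pi := by linarith [Real.pi_gt_three]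
  calc 2 * |t| * |Real.sinh (2 * Real.pi * t)| / Real.pi * Real.exp (-(2 * Real.pi) * |t|)
      ≤ 2 * |t| * Real.exp (2 * Real.pi * |t|) / 1 * Real.exp (-(2 * Real.pi) * |t|) := by gcongr
    _ = 2 * |t| * (Real.exp (2 * Real.pi * |t|) * Real.exp (-(2 * Real.pi) * |t|)) := by ring
    _ = _ := by rw [h2]; ring

def wt (a b c d : ℂ) (x : ℝ) : ℂ := gp a x * gp b x * gp c x * gp d x * Vw x

@[fun_prop] lemma measurable_gp (a : ℂ) : Measurable (gp a) := by
  unfold gp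
  exact (measurable_Gamma.comp (by fun_prop)).mul (measurable_Gamma.comp (by fun_prop))

@[fun_prop] lemma measurable_Vw : Measurable Vw := by
  unfold Vw
  exact ((measurable_Gamma.comp (by fun_prop)).mul (measurable_Gamma.comp (by fun_prop))).inv

@[fun_prop] lemma measurable_wt (a b c d : ℂ) : Measurable (wt a b c d) := by
  unfold wt; fun_prop

lemma SubExp.bound {f : ℝ → ℂ} {A c : ℝ} (hf : SubExp (fun t : ℝ => |t|) (fun t => f t * (Real.exp (A * |t|) : ℝ)))
    (hc : c < A) : ∃ C : ℝ, 0 ≤ C ∧ ∀ t, ‖f t‖ ≤ C * Real.exp (-c * |t|) := by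
  obtain ⟨C, hC, h⟩ := hf (A - c) (by linarith)
  refine ⟨C, hC, fun t => ?_⟩
  have := h t
  rw [norm_mul, Complex.norm_real, Real.norm_of_nonneg (Real.exp_pos _).le] at this
  calc ‖f t‖ = ‖f t‖ * Real.exp (A * |t|) * Real.exp (-(A * |t|)) := by
        rw [mul_assoc, ← Real.exp_add]; simp
    _ ≤ C * Real.exp ((A - c) * |t|) * Real.exp (-(A * |t|)) := by gcongr
    _ = _ := by rw [mul_assoc, ← Real.exp_add]; congr 2; ring

lemma wt_line {a b c d : ℂ} (ha : 0 < a.re) (hb : 0 < b.re) (hc : 0 < c.re) (hd : 0 < d.re) :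
    SubExp (fun t : ℝ => |t|) (fun t : ℝ => wt a b c d t * (Real.exp (2 * Real.pi * |t|) : ℝ)) := by
  refine (((((gp_line ha).mul (gp_line hb)).mul (gp_line hc)).mul (gp_line hd)).mul Vw_line).of_norm_le ?_
  intro t
  apply le_of_eq
  congr 1
  unfold wt
  have : Real.exp (2 * Real.pi * |t|) = Real.exp (Real.pi * |t|) * Real.exp (Real.pi * |t|) *
      Real.exp (Real.pi * |t|) * Real.exp (Real.pi * |t|) * Real.exp (-(2 * Real.pi) * |t|) := by
    simp only [← Real.exp_add]; congr 1; ring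
  rw [this]; push_cast; ring

lemma wt_integrable {a b c d : ℂ} (ha : 0 < a.re) (hb : 0 < b.re) (hc : 0 < c.re) (hd : 0 < d.re) :
    Integrable (wt a b c d) := by
  obtain ⟨C, _, h⟩ := (wt_line ha hb hc hd).bound (c := 1) (by nlinarith [Real.pi_gt_three])
  exact integrable_of_exp_bound (by fun_prop) one_pos h

lemma gp_add_one {a : ℂ} (ha : 0 < a.re) (x : ℝ) : gp (a + 1) x = (a ^ 2 + x ^ 2) * gp a x := by
  unfold gp
  have e1 : a + 1 + I * x = (a + I * x) + 1 := by ring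
  have e2 : a + 1 - I * x = (a - I * x) + 1 := by ring
  have n1 : a + I * x ≠ 0 := by
    intro h; have := congrArg Complex.re h; simp at this; linarith
  have n2 : a - I * x ≠ 0 := by
    intro h; have := congrArg Complex.re h; simp at this; linarith
  rw [e1, e2, Complex.Gamma_add_one _ n1, Complex.Gamma_add_one _ n2]
  have hI : I * I = -1 := Complex.I_mul_I
  linear_combination (-(x:ℂ)^2 * Complex.Gamma (a + I * x) * Complex.Gamma (a - I * x)) * hI
end part2

section part3
open MeasureTheory Classical Complex

def Hc (e : ℂ) (z : ℂ) : ℂ := Complex.Gamma (e + 1/2 + z) * Complex.Gamma (e + 1/2 - z)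

lemma Hc_subexp {e : ℂ} (he : 0 < e.re) :
    SubExp (X := {z : ℂ // |z.re| ≤ 1/2}) (fun z => |z.1.im|)
      (fun z => Hc e z.1 * (Real.exp (Real.pi * |z.1.im|) : ℝ)) := by
  have hn : ∀ z : {z : ℂ // |z.re| ≤ 1/2}, 0 ≤ |z.1.im| := fun z => abs_nonneg _
  have h := gamma_subexp (σ0 := e.re) (σ1 := e.re + 1) he
  have h1 := (h.comp (fun z : {z : ℂ // |z.re| ≤ 1/2} => (⟨e + 1/2 + z.1, by
    have := abs_le.1 z.2
    simp; constructor <;> linarith⟩ : {z : ℂ // e.re ≤ z.re ∧ z.re ≤ e.re + 1}))).mono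
      (g' := fun z => |z.1.im|) (A := |e.im|) (B := 1) zero_le_one
      (fun t => by simpa using abs_add_le e.im t.1.im) hn
  have h2 := (h.comp (fun z : {z : ℂ // |z.re| ≤ 1/2} => (⟨e + 1/2 - z.1, by
    have := abs_le.1 z.2
    simp; constructor <;> linarith⟩ : {z : ℂ // e.re ≤ z.re ∧ z.re ≤ e.re + 1}))).mono
      (g' := fun z => |z.1.im|) (A := |e.im|) (B := 1) zero_le_one
      (fun t => by simpa using abs_sub e.im t.1.im) hn
  have h3 := (SubExp.of_bounded (f := fun _ => ((Real.exp (Real.pi * |e.im|) : ℝ) : ℂ)) hn (C := _)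
    (fun _ => le_rfl)).mul (h1.mul h2)
  refine h3.of_norm_le ?_
  rintro ⟨z, hz⟩
  simp only [norm_mul, Complex.norm_real, Real.norm_of_nonneg (Real.exp_pos _).le, Hc]
  have : Real.exp (Real.pi * |z.im|) ≤ Real.exp (Real.pi * |e.im|) * (Real.exp (Real.pi / 2 * |(e + 1/2 + z).im|) *
      Real.exp (Real.pi / 2 * |(e + 1/2 - z).im|)) := by
    rw [← Real.exp_add, ← Real.exp_add, ← mul_add]
    apply Real.exp_le_exp.2
    have h1 := abs_sub (e.im + z.im) e.im
    have h2 := abs_sub e.im (e.im - z.im)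
    simp at h1 h2 ⊢
    nlinarith [Real.pi_pos]
  calc _ ≤ ‖Complex.Gamma (e + 1/2 + z)‖ * ‖Complex.Gamma (e + 1/2 - z)‖ * (Real.exp (Real.pi * |e.im|) * (Real.exp (Real.pi / 2 * |(e + 1/2 + z).im|) *
      Real.exp (Real.pi / 2 * |(e + 1/2 - z).im|))) := by gcongr
    _ = _ := by ring

lemma Hc_diff {e : ℂ} (he : 0 < e.re) {z : ℂ} (hz : |z.re| ≤ 1/2) : DifferentiableAt ℂ (Hc e) z := by
  have := abs_le.1 hz
  unfold Hc
  apply DifferentiableAt.mul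
  · refine DifferentiableAt.comp z (Complex.differentiableAt_Gamma _ ?_) (by fun_prop)
    intro m h
    have := congrArg Complex.re h
    simp at this
    have : (0:ℝ) ≤ m := Nat.cast_nonneg m
    linarith
  · refine DifferentiableAt.comp z (Complex.differentiableAt_Gamma _ ?_) (by fun_prop)
    intro m h
    have := congrArg Complex.re h
    simp at this
    have : (0:ℝ) ≤ m := Nat.cast_nonneg m
    linarith

lemma Hc_half {e : ℂ} (he : 0 < e.re) (t : ℝ) : Hc e (1/2 + I * t) = (e + I * t) * gp e t := by
  unfold Hc gp
  have n1 : e + I * t ≠ 0 := by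
    intro h; have := congrArg Complex.re h; simp at this; linarith
  rw [show e + 1/2 + (1/2 + I * t) = (e + I * t) + 1 by ring, Complex.Gamma_add_one _ n1,
    show e + 1/2 - (1/2 + I * t) = e - I * t by ring]
  ring

lemma Hc_neg_half {e : ℂ} (he : 0 < e.re) (t : ℝ) : Hc e (-1/2 + I * t) = (e - I * t) * gp e t := by
  unfold Hc gp
  have n1 : e - I * t ≠ 0 := by
    intro h; have := congrArg Complex.re h; simp at this; linarith
  rw [show e + 1/2 - (-1/2 + I * t) = (e - I * t) + 1 by ring, Complex.Gamma_add_one _ n1,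
    show e + 1/2 + (-1/2 + I * t) = e + I * t by ring]
  ring

lemma measurable_Hc (e : ℂ) : Measurable (Hc e) := by
  unfold Hc
  exact (measurable_Gamma.comp (by fun_prop)).mul (measurable_Gamma.comp (by fun_prop))

lemma wt_moment {a b c d : ℂ} (ha : 0 < a.re) (hb : 0 < b.re) (hc : 0 < c.re) (hd : 0 < d.re) :
    ∫ t : ℝ, ((a*b*c + a*b*d + a*c*d + b*c*d) - (a+b+c+d) * (t:ℂ)^2) * wt a b c d t = 0 := by
  set F : ℂ → ℂ := fun z => Complex.sin (2 * Real.pi * z) * (Hc a z * Hc b z * Hc c z * Hc d z) with hF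
  have hn : ∀ z : {z : ℂ // |z.re| ≤ 1/2}, 0 ≤ |z.1.im| := fun z => abs_nonneg _
  have hsin : SubExp (X := {z : ℂ // |z.re| ≤ 1/2}) (fun z => |z.1.im|)
      (fun z => Complex.sin (2 * Real.pi * z.1) * (Real.exp (-(2 * Real.pi) * |z.1.im|) : ℝ)) := by
    apply SubExp.of_bounded hn (C := 1)
    rintro ⟨z, hz⟩
    rw [norm_mul, Complex.norm_real, Real.norm_of_nonneg (Real.exp_pos _).le]
    have h := norm_csin_le (2 * Real.pi * z)
    have e : |(2 * Real.pi * z : ℂ).im| = 2 * Real.pi * |z.im| := by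
      have : (2 * Real.pi * z : ℂ).im = 2 * Real.pi * z.im := by simp
      rw [this, abs_mul, abs_of_pos (by positivity : 0 < 2 * Real.pi)]
    rw [e] at h
    calc _ ≤ Real.exp (2 * Real.pi * |z.im|) * Real.exp (-(2 * Real.pi) * |z.im|) := by gcongr
      _ = 1 := by rw [← Real.exp_add]; simp
  have hS := hsin.mul ((((Hc_subexp ha).mul (Hc_subexp hb)).mul (Hc_subexp hc)).mul (Hc_subexp hd))
  obtain ⟨C, hC0, hC⟩ := hS 1 one_pos
  have hb' : ∀ z : ℂ, |z.re| ≤ 1/2 → ‖F z‖ ≤ C * Real.exp (- |z.im|) := by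
    intro z hz
    have h := hC ⟨z, hz⟩
    have e : ∀ u s p q r e1 e2 : ℂ, u * e1 * (s * e2 * (p * e2) * (q * e2) * (r * e2)) =
      (u * (s * p * q * r)) * (e1 * e2 * e2 * e2 * e2) := by intros; ring
    have hre : Real.exp (2 * |z.im|) ≤ Real.exp (-(2 * Real.pi) * |z.im|) * Real.exp (Real.pi * |z.im|) *
        Real.exp (Real.pi * |z.im|) * Real.exp (Real.pi * |z.im|) * Real.exp (Real.pi * |z.im|) := by
      simp only [← Real.exp_add]
      apply Real.exp_le_exp.2
      nlinarith [Real.pi_gt_three, abs_nonneg z.im]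
    dsimp only at h
    rw [e, norm_mul] at h
    simp only [norm_mul, Complex.norm_real, Real.norm_of_nonneg (Real.exp_pos _).le] at h
    have h2 : ‖F z‖ * Real.exp (2 * |z.im|) ≤ C * Real.exp (|z.im|) := by
      calc _ ≤ ‖F z‖ * (Real.exp (-(2 * Real.pi) * |z.im|) * Real.exp (Real.pi * |z.im|) *
        Real.exp (Real.pi * |z.im|) * Real.exp (Real.pi * |z.im|) * Real.exp (Real.pi * |z.im|)) := by gcongr
        _ ≤ _ := by simp only [hF, norm_mul]; simpa using h
    calc ‖F z‖ = ‖F z‖ * Real.exp (2 * |z.im|) * Real.exp (-(2 * |z.im|)) := by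
          rw [mul_assoc, ← Real.exp_add]; simp
      _ ≤ C * Real.exp (|z.im|) * Real.exp (-(2 * |z.im|)) := by gcongr
      _ = _ := by rw [mul_assoc, ← Real.exp_add]; congr 2; ring
  have hdF : ∀ z : ℂ, |z.re| ≤ 1/2 → DifferentiableAt ℂ F z := by
    intro z hz
    have h1 := Hc_diff ha hz
    have h2 := Hc_diff hb hz
    have h3 := Hc_diff hc hz
    have h4 := Hc_diff hd hz
    have h5 : DifferentiableAt ℂ (fun z : ℂ => Complex.sin (2 * Real.pi * z)) z := by fun_prop
    exact h5.mul (((h1.mul h2).mul h3).mul h4)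
  have hmF : Measurable F := by
    have h5 : Measurable (fun z : ℂ => Complex.sin (2 * Real.pi * z)) := by fun_prop
    exact h5.mul ((((measurable_Hc a).mul (measurable_Hc b)).mul (measurable_Hc c)).mul (measurable_Hc d))
  have hshift := contour_shift hmF hdF hb'
  have hp : (Real.pi : ℂ) ≠ 0 := Complex.ofReal_ne_zero.2 Real.pi_ne_zero
  have hpt : ∀ t : ℝ, F (1/2 + I * t) - F (-1/2 + I * t) =
      Real.pi * (((a*b*c + a*b*d + a*c*d + b*c*d) - (a+b+c+d) * (t:ℂ)^2) * wt a b c d t) := by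
    intro t
    simp only [hF]
    rw [Hc_half ha, Hc_half hb, Hc_half hc, Hc_half hd, Hc_neg_half ha, Hc_neg_half hb, Hc_neg_half hc, Hc_neg_half hd]
    have s1 : Complex.sin (2 * Real.pi * (1/2 + I * t)) = -(Real.sinh (2 * Real.pi * t) * I) := by
      rw [show (2 * Real.pi * (1/2 + I * t) : ℂ) = (2 * Real.pi * t : ℝ) * I + Real.pi by push_cast; ring,
        Complex.sin_add_pi, Complex.sin_mul_I, Complex.ofReal_sinh]
    have s2 : Complex.sin (2 * Real.pi * (-1/2 + I * t)) = -(Real.sinh (2 * Real.pi * t) * I) := by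
      rw [show (2 * Real.pi * (-1/2 + I * t) : ℂ) = (2 * Real.pi * t : ℝ) * I - Real.pi by push_cast; ring,
        Complex.sin_sub_pi, Complex.sin_mul_I, Complex.ofReal_sinh]
    rw [s1, s2, wt, Vw_eq]
    push_cast
    field_simp
    have hI2 : I ^ 2 = -1 := Complex.I_sq
    have hI4 : I ^ 4 = 1 := Complex.I_pow_four
    ring_nf
    simp only [hI2, hI4]
    ring
  simp only [hpt] at hshift
  rw [integral_const_mul] at hshift
  exact (mul_eq_zero.1 hshift).resolve_left hp

def IW (a b c d : ℂ) : ℂ := ∫ t : ℝ, wt a b c d t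

lemma wt_add_one {a : ℂ} (b c d : ℂ) (ha : 0 < a.re) (x : ℝ) :
    wt (a + 1) b c d x = (a ^ 2 + x ^ 2) * wt a b c d x := by
  unfold wt; rw [gp_add_one ha]; ring

lemma IW_rec {a b c d : ℂ} (ha : 0 < a.re) (hb : 0 < b.re) (hc : 0 < c.re) (hd : 0 < d.re) :
    (a + b + c + d) * IW (a + 1) b c d = (a + b) * (a + c) * (a + d) * IW a b c d := by
  have h := wt_moment ha hb hc hd
  have i1 := wt_integrable ha hb hc hd
  have i2 : Integrable (wt (a+1) b c d) := wt_integrable (by simp; linarith) hb hc hd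
  have e : ∀ t : ℝ, ((a*b*c + a*b*d + a*c*d + b*c*d) - (a+b+c+d) * (t:ℂ)^2) * wt a b c d t =
      (a + b) * (a + c) * (a + d) * wt a b c d t - (a + b + c + d) * wt (a + 1) b c d t := by
    intro t; rw [wt_add_one b c d ha]; ring
  simp only [e] at h
  rw [integral_sub (i1.const_mul _) (i2.const_mul _), integral_const_mul, integral_const_mul] at h
  unfold IW
  linear_combination -h

lemma wt_comm12 (a b c d : ℂ) : wt a b c d = wt b a c d := by ext; unfold wt; ring
lemma wt_comm13 (a b c d : ℂ) : wt a b c d = wt c b a d := by ext; unfold wt; ring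
lemma wt_comm14 (a b c d : ℂ) : wt a b c d = wt d b c a := by ext; unfold wt; ring

def GW (a b c d : ℂ) : ℂ := Complex.Gamma (a+b) * Complex.Gamma (a+c) * Complex.Gamma (a+d) *
  Complex.Gamma (b+c) * Complex.Gamma (b+d) * Complex.Gamma (c+d) / Complex.Gamma (a+b+c+d)

lemma Gamma_ne {s : ℂ} (h : 0 < s.re) : Complex.Gamma s ≠ 0 := Complex.Gamma_ne_zero_of_re_pos h

lemma ne_zero_of_re {s : ℂ} (h : 0 < s.re) : s ≠ 0 := by rintro rfl; simp at h

lemma GW_ne {a b c d : ℂ} (ha : 0 < a.re) (hb : 0 < b.re) (hc : 0 < c.re) (hd : 0 < d.re) : GW a b c d ≠ 0 := by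
  unfold GW
  refine div_ne_zero (mul_ne_zero (mul_ne_zero (mul_ne_zero (mul_ne_zero (mul_ne_zero ?_ ?_) ?_) ?_) ?_) ?_) ?_ <;>
    (apply Gamma_ne; simp; linarith)

lemma GW_rec {a b c d : ℂ} (ha : 0 < a.re) (hb : 0 < b.re) (hc : 0 < c.re) (hd : 0 < d.re) :
    (a + b + c + d) * GW (a + 1) b c d = (a + b) * (a + c) * (a + d) * GW a b c d := by
  have n1 : a + b ≠ 0 := ne_zero_of_re (by simp; linarith)
  have n2 : a + c ≠ 0 := ne_zero_of_re (by simp; linarith)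
  have n3 : a + d ≠ 0 := ne_zero_of_re (by simp; linarith)
  have n4 : a + b + c + d ≠ 0 := ne_zero_of_re (by simp; linarith)
  have n5 : Complex.Gamma (a + b + c + d) ≠ 0 := Gamma_ne (by simp; linarith)
  unfold GW
  rw [show a + 1 + b = a + b + 1 by ring, show a + 1 + c = a + c + 1 by ring, show a + 1 + d = a + d + 1 by ring,
    show a + b + 1 + c + d = a + b + c + d + 1 by ring, Complex.Gamma_add_one _ n1, Complex.Gamma_add_one _ n2,
    Complex.Gamma_add_one _ n3, Complex.Gamma_add_one _ n4]
  field_simp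

lemma JW_nat {a b c d : ℂ} (ha : 0 < a.re) (hb : 0 < b.re) (hc : 0 < c.re) (hd : 0 < d.re) (n : ℕ) :
    IW (a + n) b c d * GW a b c d = IW a b c d * GW (a + n) b c d := by
  induction n with
  | zero => simp
  | succ n ih =>
    have han : 0 < (a + n).re := by simp; positivity
    have h1 := IW_rec han hb hc hd
    have h2 := GW_rec han hb hc hd
    have n4 : a + n + b + c + d ≠ 0 := ne_zero_of_re (by
      simp at han ⊢; linarith)
    rw [show a + ((n+1 : ℕ):ℂ) = a + n + 1 by push_cast; ring]
    apply mul_left_cancel₀ n4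
    linear_combination GW a b c d * h1 - IW a b c d * h2 + (a + n + b) * (a + n + c) * (a + n + d) * ih
end part3

section part4
open MeasureTheory Classical Complex Filter

lemma Gamma_add_nat {s : ℂ} (hs : 0 < s.re) (n : ℕ) : Complex.Gamma (s + n) = pochC s n * Complex.Gamma s := by
  induction n with
  | zero => simp [pochC]
  | succ n ih =>
    have : s + n ≠ 0 := ne_zero_of_re (by simp; positivity)
    rw [show s + ((n+1 : ℕ) : ℂ) = s + n + 1 by push_cast; ring, Complex.Gamma_add_one _ this, ih]
    unfold pochC
    rw [Finset.prod_range_succ]; ring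

def uG (s : ℂ) (n : ℕ) : ℂ := Complex.Gamma (s + (n + 1 : ℕ)) / ((n : ℂ) ^ s * n.factorial)

lemma uG_eq {s : ℂ} (hs : 0 < s.re) (n : ℕ) : uG s n = Complex.Gamma s / Complex.GammaSeq s n := by
  unfold uG Complex.GammaSeq
  rw [Gamma_add_nat hs, div_div_eq_mul_div]
  unfold pochC
  ring

lemma uG_tendsto {s : ℂ} (hs : 0 < s.re) : Tendsto (uG s) atTop (nhds 1) := by
  have h := (tendsto_const_nhds (x := Complex.Gamma s)).div (Complex.GammaSeq_tendsto_Gamma s) (Gamma_ne hs)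
  rw [div_self (Gamma_ne hs)] at h
  refine h.congr fun n => ?_
  rw [uG_eq hs]; rfl

lemma uG_norm_le {s : ℂ} (hs : 0 < s.re) {n : ℕ} (hn : 0 < n) : ‖uG s n‖ ≤ ‖uG (s.re : ℂ) n‖ := by
  unfold uG
  simp only [norm_div, norm_mul, Complex.norm_natCast_cpow_of_pos hn, Complex.ofReal_re]
  gcongr
  have h := norm_Gamma_le_re (z := s + (n + 1 : ℕ)) (by simp; positivity)
  refine h.trans ?_
  have : (s.re : ℂ) + ((n + 1 : ℕ) : ℂ) = (((s + (n+1:ℕ)).re : ℝ) : ℂ) := by simp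
  rw [this, Complex.Gamma_ofReal, Complex.norm_real]
  exact le_abs_self _

lemma uG_bdd {σ : ℝ} (hs : 0 < σ) : ∃ B : ℝ, 0 ≤ B ∧ ∀ n, ‖uG (σ : ℂ) n‖ ≤ B := by
  have h := (uG_tendsto (s := (σ:ℂ)) (by simpa using hs)).norm.bddAbove_range
  obtain ⟨B, hB⟩ := h
  refine ⟨|B|, abs_nonneg _, fun n => (hB ⟨n, rfl⟩).trans (le_abs_self _)⟩

def V3 (b c d : ℂ) (x : ℝ) : ℂ := gp b x * gp c x * gp d x * Vw x

lemma V3_integrable {b c d : ℂ} (hb : 0 < b.re) (hc : 0 < c.re) (hd : 0 < d.re) :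
    Integrable (V3 b c d) := by
  have h : SubExp (fun t : ℝ => |t|) (fun t : ℝ => V3 b c d t * (Real.exp (Real.pi * |t|) : ℝ)) := by
    refine ((((gp_line hb).mul (gp_line hc)).mul (gp_line hd)).mul Vw_line).of_norm_le ?_
    intro t
    apply le_of_eq
    congr 1
    unfold V3
    have : Real.exp (Real.pi * |t|) = Real.exp (Real.pi * |t|) *
        Real.exp (Real.pi * |t|) * Real.exp (Real.pi * |t|) * Real.exp (-(2 * Real.pi) * |t|) := by
      simp only [← Real.exp_add]; congr 1; ring
    have this' := congrArg (fun r : ℝ => (r : ℂ)) this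
    simp only [Complex.ofReal_mul] at this'
    linear_combination (gp b t * gp c t * gp d t * Vw t) * this'
  obtain ⟨C, _, h⟩ := h.bound (c := 1) (by linarith [Real.pi_gt_three])
  exact integrable_of_exp_bound (by unfold V3; fun_prop) one_pos h

lemma gp_uG (a : ℂ) (x : ℝ) {n : ℕ} (hn : 0 < n) : gp (a + (n + 1 : ℕ)) x =
    uG (a + I * x) n * uG (a - I * x) n * ((n : ℂ) ^ (2 * a) * n.factorial ^ 2) := by
  have hn' : (n : ℂ) ≠ 0 := by exact_mod_cast hn.ne'
  have hf : (n.factorial : ℂ) ≠ 0 := by exact_mod_cast n.factorial_ne_zero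
  have e : (n : ℂ) ^ (2 * a) = (n : ℂ) ^ (a + I * x) * (n : ℂ) ^ (a - I * x) := by
    rw [← Complex.cpow_add _ _ hn']; congr 1; ring
  have p1 : (n : ℂ) ^ (a + I * x) ≠ 0 := by simp [Complex.cpow_eq_zero_iff, hn']
  have p2 : (n : ℂ) ^ (a - I * x) ≠ 0 := by simp [Complex.cpow_eq_zero_iff, hn']
  unfold gp uG
  rw [e]
  field_simp
  congr 2 <;> ring

lemma tendsto_int_dom {F : ℕ → ℝ → ℂ} {f : ℝ → ℂ} (bound : ℝ → ℝ)
    (F_measurable : ∀ n, AEStronglyMeasurable (F n)) (bound_integrable : Integrable bound)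
    (h_bound : ∀ᶠ n in atTop, ∀ᵐ a, ‖F n a‖ ≤ bound a)
    (h_lim : ∀ᵐ a, Tendsto (fun n => F n a) atTop (nhds (f a))) :
    Tendsto (fun n => ∫ a, F n a) atTop (nhds (∫ a, f a)) :=
  tendsto_integral_filter_of_dominated_convergence bound (Eventually.of_forall F_measurable) h_bound bound_integrable h_lim

lemma IW_scaled_tendsto {a b c d : ℂ} (ha : 0 < a.re) (hb : 0 < b.re) (hc : 0 < c.re) (hd : 0 < d.re) :
    Tendsto (fun n : ℕ => IW (a + (n + 1 : ℕ)) b c d / ((n : ℂ) ^ (2 * a) * n.factorial ^ 2)) atTop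
      (nhds (∫ x, V3 b c d x)) := by
  obtain ⟨B, hB0, hB⟩ := uG_bdd ha
  have h : Tendsto (fun n : ℕ => ∫ x : ℝ, uG (a + I * x) n * uG (a - I * x) n * V3 b c d x) atTop
      (nhds (∫ x, V3 b c d x)) := by
    refine tendsto_int_dom (fun x => B * B * ‖V3 b c d x‖) ?_ ?_ ?_ ?_
    · intro n
      apply Measurable.aestronglyMeasurable
      have h3 : Measurable (V3 b c d) := by unfold V3; fun_prop
      refine Measurable.mul (Measurable.mul ?_ ?_) h3
      · unfold uG
        refine (measurable_Gamma.comp (by fun_prop)).div (by fun_prop)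
      · unfold uG
        refine (measurable_Gamma.comp (by fun_prop)).div (by fun_prop)
    · exact (V3_integrable hb hc hd).norm.const_mul _
    · filter_upwards [eventually_gt_atTop 0] with n hn
      refine Eventually.of_forall fun x => ?_
      rw [norm_mul, norm_mul]
      have h1 := (uG_norm_le (s := a + I * x) (by simpa using ha) hn)
      have h2 := (uG_norm_le (s := a - I * x) (by simpa using ha) hn)
      have e1 : (a + I * x).re = a.re := by simp
      have e2 : (a - I * x).re = a.re := by simp
      rw [e1] at h1
      rw [e2] at h2
      gcongr
      · exact h1.trans (hB n)
      · exact h2.trans (hB n)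
    · refine Eventually.of_forall fun x => ?_
      have h1 := (uG_tendsto (s := a + I * x) (by simpa using ha))
      have h2 := (uG_tendsto (s := a - I * x) (by simpa using ha))
      simpa using (h1.mul h2).mul_const (V3 b c d x)
  refine h.congr' ?_
  filter_upwards [eventually_gt_atTop 0] with n hn
  have hn' : (n : ℂ) ≠ 0 := by exact_mod_cast hn.ne'
  have hf : (n.factorial : ℂ) ≠ 0 := by exact_mod_cast n.factorial_ne_zero
  have p1 : (n : ℂ) ^ (2 * a) ≠ 0 := by simp [Complex.cpow_eq_zero_iff, hn']
  rw [eq_div_iff (mul_ne_zero p1 (pow_ne_zero _ hf)), IW, ← integral_mul_const]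
  congr 1
  ext x
  unfold wt V3
  rw [gp_uG a x hn]
  ring

lemma GW_scaled_tendsto {a b c d : ℂ} (ha : 0 < a.re) (hb : 0 < b.re) (hc : 0 < c.re) (hd : 0 < d.re) :
    Tendsto (fun n : ℕ => GW (a + (n + 1 : ℕ)) b c d / ((n : ℂ) ^ (2 * a) * n.factorial ^ 2)) atTop
      (nhds (Complex.Gamma (b + c) * Complex.Gamma (b + d) * Complex.Gamma (c + d))) := by
  have h1 := uG_tendsto (s := a + b) (by simp; linarith)
  have h2 := uG_tendsto (s := a + c) (by simp; linarith)
  have h3 := uG_tendsto (s := a + d) (by simp; linarith)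
  have h4 := uG_tendsto (s := a + b + c + d) (by simp; linarith)
  have h := (((h1.mul h2).mul h3).div h4 one_ne_zero).mul_const
    (Complex.Gamma (b + c) * Complex.Gamma (b + d) * Complex.Gamma (c + d))
  simp only [one_mul, div_one, mul_one] at h
  refine h.congr' ?_
  filter_upwards [eventually_gt_atTop 0] with n hn
  have hn' : (n : ℂ) ≠ 0 := by exact_mod_cast hn.ne'
  have hf : (n.factorial : ℂ) ≠ 0 := by exact_mod_cast n.factorial_ne_zero
  have p : ∀ s : ℂ, (n : ℂ) ^ s ≠ 0 := by intro s; simp [Complex.cpow_eq_zero_iff, hn']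
  have e : (n : ℂ) ^ (2 * a) * (n : ℂ) ^ (a + b + c + d) = (n : ℂ) ^ (a + b) * (n : ℂ) ^ (a + c) * (n : ℂ) ^ (a + d) := by
    simp only [← Complex.cpow_add _ _ hn']; congr 1; ring
  have p1 := p (2 * a)
  have p2 := p (a + b)
  have p3 := p (a + c)
  have p4 := p (a + d)
  have p5 := p (a + b + c + d)
  have g5 : Complex.Gamma (a + b + c + d + (n + 1 : ℕ)) ≠ 0 := Gamma_ne (by simp; positivity)
  simp only [Pi.div_apply]
  unfold uG GW
  rw [show a + ((n + 1 : ℕ):ℂ) + b = a + b + (n + 1 : ℕ) by ring, show a + ((n + 1 : ℕ):ℂ) + c = a + c + (n + 1 : ℕ) by ring,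
   show a + ((n + 1 : ℕ):ℂ) + d = a + d + (n + 1 : ℕ) by ring, show a + b + ((n + 1 : ℕ):ℂ) + c + d = a + b + c + d + (n + 1 : ℕ) by ring]
  generalize Complex.Gamma (a + b + c + d + (n + 1 : ℕ)) = g at *
  rw [div_mul_div_comm, div_mul_div_comm, div_div_div_eq, div_mul_eq_mul_div, div_div, div_eq_div_iff (by positivity) (by positivity)]
  linear_combination (Complex.Gamma (a + b + ↑(n + 1)) * Complex.Gamma (a + c + ↑(n + 1)) * Complex.Gamma (a + d + ↑(n + 1)) *
    (n.factorial : ℂ)^3 * g * Complex.Gamma (b + c) * Complex.Gamma (b + d) * Complex.Gamma (c + d)) * e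

lemma JW_eq {a b c d : ℂ} (ha : 0 < a.re) (hb : 0 < b.re) (hc : 0 < c.re) (hd : 0 < d.re) :
    IW a b c d / GW a b c d = (∫ x, V3 b c d x) / (Complex.Gamma (b + c) * Complex.Gamma (b + d) * Complex.Gamma (c + d)) := by
  have h1 := IW_scaled_tendsto ha hb hc hd
  have h2 := GW_scaled_tendsto ha hb hc hd
  have hg : Complex.Gamma (b + c) * Complex.Gamma (b + d) * Complex.Gamma (c + d) ≠ 0 := by
    refine mul_ne_zero (mul_ne_zero ?_ ?_) ?_ <;> (apply Gamma_ne; simp; linarith)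
  have h3 := h1.div h2 hg
  refine tendsto_nhds_unique (tendsto_const_nhds (f := atTop)) (h3.congr' ?_)
  filter_upwards [eventually_gt_atTop 0] with n hn
  have hn' : (n : ℂ) ≠ 0 := by exact_mod_cast hn.ne'
  have hf : (n.factorial : ℂ) ≠ 0 := by exact_mod_cast n.factorial_ne_zero
  have p1 : (n : ℂ) ^ (2 * a) ≠ 0 := by simp [Complex.cpow_eq_zero_iff, hn']
  have g1 := GW_ne ha hb hc hd
  have g2 : GW (a + (n + 1 : ℕ)) b c d ≠ 0 := GW_ne (by simp; positivity) hb hc hd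
  simp only [Pi.div_apply]
  rw [div_div_div_cancel_right₀ (by positivity), div_eq_div_iff g2 g1]
  exact JW_nat ha hb hc hd (n+1)

lemma JW_indep {a a' b c d : ℂ} (ha : 0 < a.re) (ha' : 0 < a'.re) (hb : 0 < b.re) (hc : 0 < c.re) (hd : 0 < d.re) :
    IW a b c d / GW a b c d = IW a' b c d / GW a' b c d := by
  rw [JW_eq ha hb hc hd, JW_eq ha' hb hc hd]

lemma IW_comm12 (a b c d : ℂ) : IW a b c d = IW b a c d := by unfold IW; rw [wt_comm12]
lemma IW_comm13 (a b c d : ℂ) : IW a b c d = IW c b a d := by unfold IW; rw [wt_comm13]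
lemma IW_comm14 (a b c d : ℂ) : IW a b c d = IW d b c a := by unfold IW; rw [wt_comm14]
lemma GW_comm12 (a b c d : ℂ) : GW a b c d = GW b a c d := by
  unfold GW; rw [add_comm b a]; ring
lemma GW_comm13 (a b c d : ℂ) : GW a b c d = GW c b a d := by
  unfold GW; rw [add_comm c a, add_comm c b, add_comm b a, show b + c + a + d = a + b + c + d by ring]; ring
lemma GW_comm14 (a b c d : ℂ) : GW a b c d = GW d b c a := by
  unfold GW; rw [add_comm d a, add_comm d b, add_comm d c, add_comm b a, add_comm c a, show b + d + c + a = a + b + c + d by ring]; ring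

lemma JW_const {a b c d e : ℂ} (ha : 0 < a.re) (hb : 0 < b.re) (hc : 0 < c.re) (hd : 0 < d.re) (he : 0 < e.re) :
    IW a b c d / GW a b c d = IW e (1/2) (1/2) (1/2) / GW e (1/2) (1/2) (1/2) := by
  have hh : 0 < (1/2 : ℂ).re := by norm_num
  rw [IW_comm12, GW_comm12, JW_indep (a' := 1/2) hb hh ha hc hd, IW_comm12, GW_comm12,
    IW_comm13, GW_comm13, JW_indep (a' := 1/2) hc hh hh ha hd, IW_comm13, GW_comm13,
    IW_comm14, GW_comm14, JW_indep (a' := 1/2) hd hh hh hh ha, IW_comm14, GW_comm14,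
    JW_indep ha he hh hh hh]
end part4

section part5
open MeasureTheory Classical Complex Filter

lemma gp_half (x : ℝ) : gp (1/2) x = ((Real.pi / Real.cosh (Real.pi * x) : ℝ) : ℂ) := by
  have h := Complex.Gamma_mul_Gamma_one_sub (1/2 + I * x)
  unfold gp
  rw [show (1/2 - I * x : ℂ) = 1 - (1/2 + I * x) by ring, h]
  have : Complex.sin (Real.pi * (1/2 + I * x)) = Real.cosh (Real.pi * x) := by
    rw [show (Real.pi * (1/2 + I * x) : ℂ) = ((Real.pi * x : ℝ) : ℂ) * I + Real.pi / 2 by push_cast; ring,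
      Complex.sin_add_pi_div_two, Complex.cos_mul_I, Complex.ofReal_cosh]
  rw [this]; push_cast; rfl

lemma gp_one {x : ℝ} (hx : x ≠ 0) : gp 1 x = ((Real.pi * x / Real.sinh (Real.pi * x) : ℝ) : ℂ) := by
  have h := Complex.Gamma_mul_Gamma_one_sub (I * x)
  have hx' : (I * x : ℂ) ≠ 0 := by simp [hx]
  unfold gp
  rw [add_comm, Complex.Gamma_add_one _ hx', mul_assoc, h]
  have : Complex.sin (Real.pi * (I * x)) = Real.sinh (Real.pi * x) * I := by
    rw [show (Real.pi * (I * x) : ℂ) = ((Real.pi * x : ℝ) : ℂ) * I by push_cast; ring,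
      Complex.sin_mul_I, Complex.ofReal_sinh]
  rw [this]
  have hs : ((Real.sinh (Real.pi * x) : ℝ) : ℂ) ≠ 0 := by
    rw [Complex.ofReal_ne_zero]; simp [Real.sinh_eq_zero, hx, Real.pi_ne_zero]
  have := Complex.I_ne_zero
  push_cast at hs ⊢
  field_simp

lemma abs_sinh_le (y : ℝ) : |Real.sinh y| ≤ |y| * Real.cosh y := by
  have h := Convex.norm_image_sub_le_of_norm_deriv_le (f := Real.sinh) (s := Set.Icc (-|y|) |y|) (C := Real.cosh y)
    (x := 0) (y := y) (fun x _ => Real.differentiable_sinh x) (fun x hx => by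
      rw [Real.deriv_sinh, Real.norm_of_nonneg (Real.cosh_pos x).le]
      exact Real.cosh_le_cosh.2 (abs_le.2 hx)) (convex_Icc _ _) (by simp) (abs_le.1 le_rfl)
  simp at h
  linarith [mul_comm |y| (Real.cosh y)]

lemma inv_cosh_le (y : ℝ) : (Real.cosh y)⁻¹ ≤ 2 * Real.exp (-|y|) := by
  rw [inv_le_iff_one_le_mul₀ (Real.cosh_pos _), ← Real.cosh_abs y, Real.cosh_eq]
  have : Real.exp (|y|) * Real.exp (-|y|) = 1 := by rw [← Real.exp_add]; simp
  nlinarith [Real.exp_pos (-|y|)]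

lemma integrable_inv_cosh : Integrable (fun x : ℝ => (Real.cosh (Real.pi * x))⁻¹) := by
  refine Integrable.mono' ((integrable_exp_neg_abs Real.pi_pos).const_mul 2) ?_ (Eventually.of_forall fun t => ?_)
  · apply Measurable.aestronglyMeasurable
    exact (Real.measurable_cosh.comp (by fun_prop)).inv
  · rw [Real.norm_of_nonneg (inv_nonneg.2 (Real.cosh_pos _).le)]
    have := inv_cosh_le (Real.pi * t)
    rwa [abs_mul, abs_of_pos Real.pi_pos, ← neg_mul] at this

lemma integral_cosh_sq : ∫ x : ℝ, (Real.cosh (Real.pi * x) ^ 2)⁻¹ = 2 / Real.pi := by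
  have hd : ∀ x : ℝ, HasDerivAt (fun x : ℝ => -(2 / Real.pi) * (Real.exp (2 * Real.pi * x) + 1)⁻¹)
      ((Real.cosh (Real.pi * x) ^ 2)⁻¹) x := by
    intro x
    have h0 : HasDerivAt (fun x : ℝ => 2 * Real.pi * x) (2 * Real.pi) x := by
      simpa using (hasDerivAt_id x).const_mul (2 * Real.pi)
    have hne : Real.exp (2 * Real.pi * x) + 1 ≠ 0 := by positivity
    have h1 := ((h0.exp.add_const 1).inv hne).const_mul (-(2 / Real.pi))
    refine h1.congr_deriv ?_
    have e : Real.exp (2 * Real.pi * x) = Real.exp (Real.pi * x) ^ 2 := by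
      rw [← Real.exp_nat_mul]; congr 1; push_cast; ring
    rw [Real.cosh_eq, Real.exp_neg, e]
    have := Real.exp_pos (Real.pi * x)
    have := Real.pi_ne_zero
    field_simp
  have hInteg : Integrable (fun x : ℝ => (Real.cosh (Real.pi * x) ^ 2)⁻¹) := by
    refine integrable_inv_cosh.mono' ?_ (Eventually.of_forall fun t => ?_)
    · apply Measurable.aestronglyMeasurable
      exact ((Real.measurable_cosh.comp (by fun_prop)).pow_const 2).inv
    · rw [Real.norm_of_nonneg (by positivity)]
      apply inv_anti₀ (Real.cosh_pos _)
      nlinarith [Real.one_le_cosh (Real.pi * t)]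
  have p2 : 0 < 2 * Real.pi := by positivity
  have hbot : Tendsto (fun x : ℝ => -(2 / Real.pi) * (Real.exp (2 * Real.pi * x) + 1)⁻¹) atBot (nhds (-(2 / Real.pi) * (0 + 1)⁻¹)) := by
    refine Tendsto.const_mul _ (Tendsto.inv₀ (Tendsto.add_const _ ?_) (by norm_num))
    exact Real.tendsto_exp_atBot.comp (tendsto_id.const_mul_atBot p2)
  have htop : Tendsto (fun x : ℝ => -(2 / Real.pi) * (Real.exp (2 * Real.pi * x) + 1)⁻¹) atTop (nhds (-(2 / Real.pi) * 0)) := by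
    refine Tendsto.const_mul _ (tendsto_inv_atTop_zero.comp (tendsto_atTop_add_const_right _ _ ?_))
    exact Real.tendsto_exp_atTop.comp (tendsto_id.const_mul_atTop p2)
  rw [integral_of_hasDerivAt_of_tendsto hd hInteg hbot htop]
  norm_num

def kk (x : ℝ) : ℝ := 4 * Real.pi ^ 2 * x * Real.sinh (Real.pi * x) / Real.cosh (Real.pi * x) ^ 2

lemma wt_half {ε : ℝ} (hε : 0 < ε) (x : ℝ) :
    wt ε (1/2) (1/2) (1/2) x = gp (1 + ε) x * ((kk x / (ε ^ 2 + x ^ 2) : ℝ) : ℂ) := by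
  have h := gp_add_one (a := ε) (by simpa using hε) x
  have hne : ((ε ^ 2 + x ^ 2 : ℝ) : ℂ) ≠ 0 := by
    rw [Complex.ofReal_ne_zero]; positivity
  have hc : ((Real.cosh (Real.pi * x) : ℝ) : ℂ) ≠ 0 := Complex.ofReal_ne_zero.2 (Real.cosh_pos _).ne'
  have hp : (Real.pi : ℂ) ≠ 0 := Complex.ofReal_ne_zero.2 Real.pi_ne_zero
  unfold wt kk
  rw [add_comm (1:ℂ), h, gp_half, Vw_eq, show 2 * Real.pi * x = 2 * (Real.pi * x) by ring, Real.sinh_two_mul]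
  push_cast at hne hc ⊢
  field_simp
  ring

lemma base_int : Tendsto (fun ε : ℝ => IW ε (1/2) (1/2) (1/2)) (nhdsWithin 0 (Set.Ioi 0)) (nhds (8 * Real.pi ^ 2)) := by
  have hlim : (8 * Real.pi ^ 2 : ℂ) = ∫ x : ℝ, ((4 * Real.pi ^ 3 * (Real.cosh (Real.pi * x) ^ 2)⁻¹ : ℝ) : ℂ) := by
    rw [integral_complex_ofReal, integral_const_mul, integral_cosh_sq]
    have := Real.pi_ne_zero
    rw [show 4 * Real.pi ^ 3 * (2 / Real.pi) = 8 * Real.pi ^ 2 by field_simp; ring]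
    push_cast; rfl
  rw [hlim]
  have hG : ∀ᶠ ε : ℝ in nhdsWithin 0 (Set.Ioi 0), Real.Gamma (1 + ε) < 2 := by
    have h1 : ContinuousAt (fun ε : ℝ => Real.Gamma (1 + ε)) 0 := by
      refine ContinuousAt.comp (f := fun ε : ℝ => 1 + ε) (g := Real.Gamma) ?_ (by fun_prop)
      refine (Real.differentiableAt_Gamma (fun m h => ?_)).continuousAt
      have : (0:ℝ) ≤ m := Nat.cast_nonneg m
      simp at h; linarith
    have h2 : Tendsto (fun ε : ℝ => Real.Gamma (1 + ε)) (nhdsWithin 0 (Set.Ioi 0)) (nhds 1) := by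
      have := h1.tendsto
      simp at this
      exact this.mono_left nhdsWithin_le_nhds
    exact h2.eventually_lt_const (by norm_num)
  refine tendsto_integral_filter_of_dominated_convergence
    (fun x => 16 * Real.pi ^ 3 * (Real.cosh (Real.pi * x))⁻¹) ?_ ?_ (integrable_inv_cosh.const_mul _) ?_
  · exact Eventually.of_forall fun ε => (measurable_wt _ _ _ _).aestronglyMeasurable
  · filter_upwards [hG, self_mem_nhdsWithin] with ε hε hε0
    have hε0 : 0 < ε := hε0
    refine Eventually.of_forall fun x => ?_
    rw [wt_half hε0, norm_mul, Complex.norm_real]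
    have b1 : ‖gp (1 + ε) x‖ ≤ 4 := by
      unfold gp
      rw [norm_mul]
      have e1 : ∀ z : ℂ, z.re = 1 + ε → ‖Complex.Gamma z‖ ≤ 2 := by
        intro z hz
        have := norm_Gamma_le_re (z := z) (by rw [hz]; linarith)
        rw [hz] at this; linarith
      have h1 := e1 (1 + ε + I * x) (by simp)
      have h2 := e1 (1 + ε - I * x) (by simp)
      nlinarith [norm_nonneg (Complex.Gamma (1 + ε + I * x)), norm_nonneg (Complex.Gamma (1 + ε - I * x))]
    have b2 : ‖kk x / (ε ^ 2 + x ^ 2)‖ ≤ 4 * Real.pi ^ 3 * (Real.cosh (Real.pi * x))⁻¹ := by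
      have hcp := Real.cosh_pos (Real.pi * x)
      have hs := abs_sinh_le (Real.pi * x)
      rw [abs_mul, abs_of_pos Real.pi_pos] at hs
      rw [norm_div, Real.norm_eq_abs, Real.norm_of_nonneg (by positivity : 0 ≤ ε ^ 2 + x ^ 2), div_le_iff₀ (by positivity)]
      unfold kk
      rw [abs_div, abs_mul, abs_mul, abs_of_pos (by positivity : 0 < 4 * Real.pi ^ 2),
        abs_of_pos (by positivity : 0 < Real.cosh (Real.pi * x) ^ 2), div_le_iff₀ (by positivity)]
      have : 4 * Real.pi ^ 3 * (Real.cosh (Real.pi * x))⁻¹ * (ε ^ 2 + x ^ 2) * Real.cosh (Real.pi * x) ^ 2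
         = 4 * Real.pi ^ 3 * (ε ^ 2 + x ^ 2) * Real.cosh (Real.pi * x) := by field_simp
      rw [this]
      calc 4 * Real.pi ^ 2 * |x| * |Real.sinh (Real.pi * x)| ≤ 4 * Real.pi ^ 2 * |x| * (Real.pi * |x| * Real.cosh (Real.pi * x)) := by gcongr
        _ = 4 * Real.pi ^ 3 * (|x| ^ 2) * Real.cosh (Real.pi * x) := by ring
        _ ≤ _ := by rw [sq_abs]; gcongr; nlinarith
    calc _ ≤ 4 * (4 * Real.pi ^ 3 * (Real.cosh (Real.pi * x))⁻¹) := by gcongr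
      _ = _ := by ring
  · have hae : ∀ᵐ x : ℝ, x ≠ 0 := by simp [ae_iff]
    filter_upwards [hae] with x hx
    have hsx : Real.sinh (Real.pi * x) ≠ 0 := by simp [Real.sinh_eq_zero, hx, Real.pi_ne_zero]
    have hcp := (Real.cosh_pos (Real.pi * x)).ne'
    have e : ((4 * Real.pi ^ 3 * (Real.cosh (Real.pi * x) ^ 2)⁻¹ : ℝ) : ℂ) = gp (1 + (0:ℝ)) x * ((kk x / (0 ^ 2 + x ^ 2) : ℝ) : ℂ) := by
      rw [Complex.ofReal_zero, add_zero, gp_one hx, ← Complex.ofReal_mul]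
      congr 1
      unfold kk
      field_simp
      ring
    rw [e]
    have hc : ContinuousAt (fun ε : ℝ => gp (1 + ε) x * ((kk x / (ε ^ 2 + x ^ 2) : ℝ) : ℂ)) 0 := by
      refine ContinuousAt.mul ?_ ?_
      · unfold gp
        refine ContinuousAt.mul ?_ ?_
        · refine ContinuousAt.comp (f := fun ε : ℝ => (1 + ε + I * x : ℂ)) (g := Complex.Gamma) ?_ (by fun_prop)
          refine (Complex.differentiableAt_Gamma _ (fun m h => ?_)).continuousAt
          have := congrArg Complex.re h
          have : (0:ℝ) ≤ m := Nat.cast_nonneg m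
          simp at *; linarith
        · refine ContinuousAt.comp (f := fun ε : ℝ => (1 + ε - I * x : ℂ)) (g := Complex.Gamma) ?_ (by fun_prop)
          refine (Complex.differentiableAt_Gamma _ (fun m h => ?_)).continuousAt
          have := congrArg Complex.re h
          have : (0:ℝ) ≤ m := Nat.cast_nonneg m
          simp at *; linarith
      · refine Complex.continuous_ofReal.continuousAt.comp ?_
        refine ContinuousAt.div (by fun_prop) (by fun_prop) ?_
        positivity
    refine (hc.tendsto.mono_left nhdsWithin_le_nhds).congr' ?_
    filter_upwards [self_mem_nhdsWithin] with ε hε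
    rw [wt_half hε]

lemma base_GW : Tendsto (fun ε : ℝ => GW ε (1/2) (1/2) (1/2)) (nhdsWithin 0 (Set.Ioi 0)) (nhds (2 * Real.pi)) := by
  have hc : ContinuousAt (fun ε : ℝ => GW ε (1/2) (1/2) (1/2)) 0 := by
    unfold GW
    have h : ∀ z : ℂ, 0 < z.re → ContinuousAt (fun ε : ℝ => Complex.Gamma (ε + z)) 0 := by
      intro z hz
      refine ContinuousAt.comp (f := fun ε : ℝ => (ε + z : ℂ)) (g := Complex.Gamma) ?_ (by fun_prop)
      refine (Complex.differentiableAt_Gamma _ (fun m h => ?_)).continuousAt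
      have := congrArg Complex.re h
      have : (0:ℝ) ≤ m := Nat.cast_nonneg m
      simp at *; linarith
    have h1 := h (1/2) (by norm_num)
    have h2 := h (1/2 + 1/2 + 1/2) (by norm_num)
    simp only [← add_assoc] at h2
    refine ContinuousAt.div (by fun_prop) h2 ?_
    apply Gamma_ne; norm_num
  have hv : GW ((0:ℝ):ℂ) (1/2) (1/2) (1/2) = 2 * Real.pi := by
    unfold GW
    have h3 : Complex.Gamma (1/2 + 1) = 1/2 * Complex.Gamma (1/2) := Complex.Gamma_add_one _ (by norm_num)
    rw [show ((0:ℝ):ℂ) + 1/2 + 1/2 + 1/2 = 1/2 + 1 by norm_num, h3]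
    rw [show (1/2 + 1/2 : ℂ) = 1 by norm_num, Complex.Gamma_one]
    simp only [Complex.ofReal_zero, zero_add]
    have hg : Complex.Gamma (1/2) ≠ 0 := Gamma_ne (by norm_num)
    have hsq : Complex.Gamma (1/2) ^ 2 = Real.pi := by
      have := gp_half 0
      simp [gp] at this
      simpa [sq] using this
    field_simp
    linear_combination hsq
  rw [← hv]
  exact hc.tendsto.mono_left nhdsWithin_le_nhds

theorem IW_eq {a b c d : ℂ} (ha : 0 < a.re) (hb : 0 < b.re) (hc : 0 < c.re) (hd : 0 < d.re) :
    IW a b c d = 4 * Real.pi * GW a b c d := by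
  have hp : (Real.pi : ℂ) ≠ 0 := Complex.ofReal_ne_zero.2 Real.pi_ne_zero
  have h := base_int.div base_GW (by simp)
  have h2 : IW a b c d / GW a b c d = 8 * Real.pi ^ 2 / (2 * Real.pi) := by
    refine tendsto_nhds_unique (tendsto_const_nhds (f := nhdsWithin (0:ℝ) (Set.Ioi 0))) (h.congr' ?_)
    filter_upwards [self_mem_nhdsWithin] with ε hε
    exact (JW_const ha hb hc hd (by simpa using hε)).symm
  rw [div_eq_iff (GW_ne ha hb hc hd)] at h2
  rw [h2]
  field_simp
  ring
end part5

section part6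
open MeasureTheory Classical Complex Filter

def DD (n : ℕ) (f : ℕ → ℂ) : ℂ := ∑ k ∈ Finset.range (n + 1), (-1 : ℂ) ^ k * (n.choose k : ℂ) * f k

lemma DD_succ (n : ℕ) (f : ℕ → ℂ) : DD (n + 1) f = DD n f - DD n (fun k => f (k + 1)) := by
  have h1 : DD n f = ∑ k ∈ Finset.range (n + 1), (-1 : ℂ) ^ (k + 1) * (n.choose (k + 1) : ℂ) * f (k + 1) + f 0 := by
    have h := Finset.sum_range_succ' (fun k => (-1 : ℂ) ^ k * (n.choose k : ℂ) * f k) (n + 1)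
    rw [Finset.sum_range_succ] at h
    simp only [Nat.choose_succ_self, Nat.cast_zero, mul_zero, zero_mul, add_zero] at h
    unfold DD
    rw [h]; simp
  rw [h1]
  unfold DD
  rw [Finset.sum_range_succ']
  simp only [Nat.choose_succ_succ, Nat.cast_add, pow_zero, Nat.choose_zero_right, Nat.cast_one, one_mul]
  rw [add_sub_right_comm, ← Finset.sum_sub_distrib]
  congr 1
  apply Finset.sum_congr rfl
  intro k _
  ring

lemma DD_mul_k (n : ℕ) (f : ℕ → ℂ) : DD (n + 1) (fun k => k * f k) = -(n + 1) * DD n (fun k => f (k + 1)) := by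
  unfold DD
  rw [Finset.sum_range_succ', Finset.mul_sum]
  simp only [Nat.cast_zero, zero_mul, mul_zero, add_zero]
  apply Finset.sum_congr rfl
  intro k _
  have h : ((n : ℂ) + 1) * n.choose k = (n + 1).choose (k + 1) * (k + 1) := by
    exact_mod_cast Nat.add_one_mul_choose_eq n k
  push_cast
  linear_combination (-1) ^ k * f (k + 1) * h

lemma DD_add (n : ℕ) (f g : ℕ → ℂ) : DD n (fun k => f k + g k) = DD n f + DD n g := by
  unfold DD; rw [← Finset.sum_add_distrib]; apply Finset.sum_congr rfl; intros; ring

lemma DD_smul (n : ℕ) (r : ℂ) (f : ℕ → ℂ) : DD n (fun k => r * f k) = r * DD n f := by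
  unfold DD; rw [Finset.mul_sum]; apply Finset.sum_congr rfl; intros; ring

lemma DD_prod (j n : ℕ) (h : j < n) (β : ℕ → ℂ) : DD n (fun k => ∏ i ∈ Finset.range j, (β i + k)) = 0 := by
  induction j generalizing n β with
  | zero =>
    obtain ⟨n, rfl⟩ := Nat.exists_eq_succ_of_ne_zero h.ne'
    simp [DD_succ]
  | succ j ih =>
    obtain ⟨n, rfl⟩ := Nat.exists_eq_succ_of_ne_zero (by omega : n ≠ 0)
    have e : (fun k : ℕ => ∏ i ∈ Finset.range (j + 1), (β i + k)) =
        fun k : ℕ => β j * (∏ i ∈ Finset.range j, (β i + k)) + k * ∏ i ∈ Finset.range j, (β i + k) := by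
      ext k; rw [Finset.prod_range_succ]; ring
    have e2 : (fun k : ℕ => ∏ i ∈ Finset.range j, (β i + (k + 1 : ℕ))) = fun k : ℕ => ∏ i ∈ Finset.range j, (β i + 1 + k) := by
      ext k; apply Finset.prod_congr rfl; intros; push_cast; ring
    rw [e, DD_add, DD_smul, ih _ (by omega), DD_mul_k, e2, ih n (by omega) (fun i => β i + 1)]
    ring

lemma pochC_succ (z : ℂ) (n : ℕ) : pochC z (n + 1) = pochC z n * (z + n) := by
  unfold pochC; rw [Finset.prod_range_succ]

lemma pochC_succ' (z : ℂ) (n : ℕ) : pochC z (n + 1) = z * pochC (z + 1) n := by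
  unfold pochC; rw [Finset.prod_range_succ', mul_comm]
  simp only [Nat.cast_zero, add_zero]
  congr 1
  apply Finset.prod_congr rfl; intros; push_cast; ring

lemma pochC_ne {z : ℂ} (hz : 0 < z.re) (n : ℕ) : pochC z n ≠ 0 := by
  unfold pochC
  refine Finset.prod_ne_zero_iff.2 fun i _ => ne_zero_of_re ?_
  simp; positivity

lemma DD_inv (n : ℕ) {z : ℂ} (hz : 0 < z.re) : DD n (fun k => (z + k)⁻¹) = n.factorial / pochC z (n + 1) := by
  induction n generalizing z with
  | zero => simp [DD, pochC]
  | succ n ih =>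
    have hz1 : 0 < (z + 1).re := by simp; linarith
    have e2 : (fun k : ℕ => (z + (k + 1 : ℕ))⁻¹) = fun k : ℕ => (z + 1 + k)⁻¹ := by
      ext k; congr 1; push_cast; ring
    rw [DD_succ, ih hz, e2, ih hz1]
    have h1 := pochC_ne hz (n + 1)
    have h2 := pochC_ne hz1 (n + 1)
    have h3 := pochC_ne hz (n + 1 + 1)
    have p1 := pochC_succ z (n + 1)
    have p2 := pochC_succ' z (n + 1)
    have z0 : z ≠ 0 := ne_zero_of_re hz
    have z1 : z + (n + 1 : ℕ) ≠ 0 := by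
      apply ne_zero_of_re; simp; positivity
    have q1 : pochC z (n + 1) = pochC z (n + 1 + 1) / (z + (n + 1 : ℕ)) := by rw [p1]; field_simp
    have q2 : pochC (z + 1) (n + 1) = pochC z (n + 1 + 1) / z := by rw [p2]; field_simp
    rw [q1, q2, Nat.factorial_succ]
    field_simp
    push_cast; ring

lemma DD_frac (j n : ℕ) (h : j ≤ n) (β : ℕ → ℂ) {z : ℂ} (hz : 0 < z.re) :
    DD n (fun k => (∏ i ∈ Finset.range j, (β i + k)) * (z + k)⁻¹) =
      (∏ i ∈ Finset.range j, (β i - z)) * (n.factorial / pochC z (n + 1)) := by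
  induction j with
  | zero => simpa using DD_inv n hz
  | succ j ih =>
    have e : (fun k : ℕ => (∏ i ∈ Finset.range (j+1), (β i + k)) * (z + k)⁻¹) =
        fun k : ℕ => (∏ i ∈ Finset.range j, (β i + k)) + (β j - z) * ((∏ i ∈ Finset.range j, (β i + k)) * (z + k)⁻¹) := by
      ext k
      have : z + k ≠ 0 := by apply ne_zero_of_re; simp; positivity
      rw [Finset.prod_range_succ]; field_simp; ring
    rw [e, DD_add, DD_smul, DD_prod j n (by omega), ih (by omega), Finset.prod_range_succ]
    ring

def phi (a : ℂ) (k : ℕ) (x : ℝ) : ℂ := ∏ i ∈ Finset.range k, ((a + i) ^ 2 + x ^ 2)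

lemma poch_phi (a : ℂ) (k : ℕ) (x : ℝ) : pochC (a + I * x) k * pochC (a - I * x) k = phi a k x := by
  unfold pochC phi
  rw [← Finset.prod_mul_distrib]
  apply Finset.prod_congr rfl
  intro i _
  have := Complex.I_sq
  linear_combination (- (x:ℂ)^2) * this

lemma phi_mul_wt {a : ℂ} (ha : 0 < a.re) (b c d : ℂ) (k : ℕ) (x : ℝ) :
    phi a k x * wt a b c d x = wt (a + k) b c d x := by
  induction k with
  | zero => simp [phi]
  | succ k ih =>
    have : wt (a + (k + 1 : ℕ)) b c d x = wt (a + k + 1) b c d x := by push_cast; rw [add_assoc]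
    rw [this, wt_add_one b c d (by simp; positivity), ← ih]
    unfold phi; rw [Finset.prod_range_succ]; ring

lemma phi_phi_wt {a b : ℂ} (ha : 0 < a.re) (hb : 0 < b.re) (c d : ℂ) (k j : ℕ) (x : ℝ) :
    phi a k x * (phi b j x * wt a b c d x) = wt (a + k) (b + j) c d x := by
  rw [wt_comm12 a b, phi_mul_wt hb, wt_comm12, phi_mul_wt ha]

def wco (a b c d : ℂ) (n k : ℕ) : ℂ := pochC (a + b) n * pochC (a + c) n * pochC (a + d) n *
  (pochC (-(n : ℂ)) k * pochC ((n : ℂ) + a + b + c + d - 1) k /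
      ((k.factorial : ℂ) * pochC (a + b) k * pochC (a + c) k * pochC (a + d) k))

lemma wilsonP_eq (a b c d : ℂ) (n : ℕ) (x : ℝ) :
    wilsonP a b c d n x = ∑ k ∈ Finset.range (n + 1), wco a b c d n k * phi a k x := by
  unfold wilsonP wco
  rw [Finset.mul_sum]
  apply Finset.sum_congr rfl
  intro k _
  rw [← poch_phi]
  ring

lemma poch_neg (n k : ℕ) : pochC (-(n : ℂ)) k / k.factorial = (-1) ^ k * n.choose k := by
  have hf : ∀ k : ℕ, (k.factorial : ℂ) ≠ 0 := fun k => by exact_mod_cast k.factorial_ne_zero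
  induction k with
  | zero => simp [pochC]
  | succ k ih =>
    rw [div_eq_iff (hf k)] at ih
    rw [pochC_succ, ih, div_eq_iff (hf _), Nat.factorial_succ]
    have h : ((n.choose (k + 1) : ℕ) : ℂ) * (k + 1) = n.choose k * (n - k) := by
      by_cases hk : k ≤ n
      · have := Nat.choose_succ_right_eq n k
        rw [← Nat.cast_sub hk]
        exact_mod_cast this
      · simp [Nat.choose_eq_zero_of_lt (by omega : n < k), Nat.choose_eq_zero_of_lt (by omega : n < k + 1)]
    push_cast
    linear_combination ((-1) ^ k * (k.factorial : ℂ)) * h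

def KK (a b c d : ℂ) (n : ℕ) : ℂ := 4 * Real.pi * (n.factorial * Complex.Gamma (a + b + n) * Complex.Gamma (c + d + n) *
    (Complex.Gamma (a + c + n) * Complex.Gamma (a + d + n) * Complex.Gamma (b + c + n) * Complex.Gamma (b + d + n)) /
      Complex.Gamma (a + b + c + d + 2 * n))

lemma alg1 {P1 P2 P3 q z f p1 p2 p3 r g1 g2 g3 g4 g5 g6 g : ℂ} (hf : f ≠ 0) (h1 : p1 ≠ 0) (h2 : p2 ≠ 0) (h3 : p3 ≠ 0)
    (hg : g ≠ 0) : P1 * P2 * P3 * (q * z / (f * p1 * p2 * p3)) * (r * (p1 * g1) * (p2 * g2) * (p3 * g3) * g4 * g5 * g6 / g) =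
    (P1 * P2 * P3 * g1 * g2 * g3 * g4 * g5 * g6) * (q / f * (r * (z / g))) := by
  have e1 := mul_inv_cancel₀ h1
  have e2 := mul_inv_cancel₀ h2
  have e3 := mul_inv_cancel₀ h3
  simp only [div_eq_mul_inv, mul_inv]
  generalize p1⁻¹ = i1 at *
  generalize p2⁻¹ = i2 at *
  generalize p3⁻¹ = i3 at *
  calc _ = (P1 * P2 * P3 * g1 * g2 * g3 * g4 * g5 * g6) * (q * f⁻¹ * (r * (z * g⁻¹))) * ((p1 * i1) * (p2 * i2) * (p3 * i3)) := by ring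
    _ = _ := by rw [e1, e2, e3]; ring

lemma alg2 {p P1 P2 P3 g1 g2 g3 g4 g5 g6 g s c f q : ℂ} :
    4 * p * (P1 * P2 * P3 * g1 * g2 * g3 * g4 * g5 * g6 * (g⁻¹ * (s * c * (f / q)))) =
    s * (4 * p * (f * (P1 * g1) * (c * g6) * ((P2 * g2) * (P3 * g3) * g4 * g5) / (q * g))) := by
  rw [div_eq_mul_inv, div_eq_mul_inv, mul_inv]; ring

lemma wco_GW {a b c d : ℂ} (ha : 0 < a.re) (hb : 0 < b.re) (hc : 0 < c.re) (hd : 0 < d.re) (n j k : ℕ) :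
    wco a b c d n k * GW (a + k) (b + j) c d = (pochC (a + b) n * pochC (a + c) n * pochC (a + d) n *
      Complex.Gamma (a + b) * Complex.Gamma (a + c) * Complex.Gamma (a + d) * Complex.Gamma (b + c + j) * Complex.Gamma (b + d + j) *
      Complex.Gamma (c + d)) * ((-1) ^ k * n.choose k * (pochC (a + b + k) j *
        (pochC ((n : ℂ) + a + b + c + d - 1) k / Complex.Gamma (a + b + c + d + j + k)))) := by
  have h1 : 0 < (a + b).re := by simp; linarith
  have h2 : 0 < (a + c).re := by simp; linarith
  have h3 : 0 < (a + d).re := by simp; linarith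
  have p1 := pochC_ne h1 k
  have p2 := pochC_ne h2 k
  have p3 := pochC_ne h3 k
  have hk : (k.factorial : ℂ) ≠ 0 := by exact_mod_cast k.factorial_ne_zero
  have hg : Complex.Gamma (a + b + c + d + j + k) ≠ 0 := Gamma_ne (by simp; positivity)
  unfold wco GW
  rw [show a + k + (b + j) + c + d = a + b + c + d + j + k by ring, show a + k + (b + j) = a + b + k + j by ring,
    show a + k + c = a + c + k by ring, show a + k + d = a + d + k by ring, show b + j + c = b + c + j by ring,
    show b + j + d = b + d + j by ring, Gamma_add_nat (s := a + b + k) (by simp; positivity),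
    Gamma_add_nat h1, Gamma_add_nat h2, Gamma_add_nat h3, ← poch_neg]
  exact alg1 hk p1 p2 p3 hg

lemma sum_wco_lt {a b c d : ℂ} (ha : 0 < a.re) (hb : 0 < b.re) (hc : 0 < c.re) (hd : 0 < d.re) {n j : ℕ} (hj : j < n) :
    ∑ k ∈ Finset.range (n + 1), wco a b c d n k * GW (a + k) (b + j) c d = 0 := by
  simp only [wco_GW ha hb hc hd]
  rw [← Finset.mul_sum]
  apply mul_eq_zero_of_right
  obtain ⟨r, rfl⟩ : ∃ r, n = j + 1 + r := ⟨n - (j + 1), by omega⟩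
  have h0 : 0 < ((j + 1 + r : ℕ) + a + b + c + d - 1).re := by simp; linarith [Nat.cast_nonneg (α := ℝ) j, Nat.cast_nonneg (α := ℝ) r]
  have e : ∀ k : ℕ, pochC (a + b + k) j * (pochC (((j + 1 + r : ℕ) : ℂ) + a + b + c + d - 1) k / Complex.Gamma (a + b + c + d + j + k)) =
      (Complex.Gamma (((j + 1 + r : ℕ) : ℂ) + a + b + c + d - 1))⁻¹ * ∏ i ∈ Finset.range (j + r),
        ((if i < j then a + b + i else a + b + c + d + i) + (k : ℂ)) := by
    intro k
    have g0 := Gamma_ne h0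
    have hs : 0 < (a + b + c + d + j + k).re := by simp; positivity
    have g1 := Gamma_ne hs
    have q1 := Gamma_add_nat h0 k
    have q2 := Gamma_add_nat hs r
    rw [show a + b + c + d + j + k + r = ((j + 1 + r : ℕ) : ℂ) + a + b + c + d - 1 + k by push_cast; ring] at q2
    rw [q1] at q2
    have q3 : pochC (((j + 1 + r : ℕ) : ℂ) + a + b + c + d - 1) k / Complex.Gamma (a + b + c + d + j + k) =
      (Complex.Gamma (((j + 1 + r : ℕ) : ℂ) + a + b + c + d - 1))⁻¹ * pochC (a + b + c + d + j + k) r := by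
      field_simp; linear_combination q2
    rw [q3, Finset.prod_range_add]
    have e1 : ∏ i ∈ Finset.range j, ((if i < j then a + b + i else a + b + c + d + i) + (k : ℂ)) = pochC (a + b + k) j := by
      unfold pochC
      apply Finset.prod_congr rfl
      intro i hi
      rw [if_pos (Finset.mem_range.1 hi)]; ring
    have e2 : ∏ i ∈ Finset.range r, ((if j + i < j then a + b + ((j + i : ℕ) : ℂ) else a + b + c + d + ((j + i : ℕ) : ℂ)) + (k : ℂ)) = pochC (a + b + c + d + j + k) r := by
      unfold pochC
      apply Finset.prod_congr rfl
      intro i hi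
      rw [if_neg (by omega)]; push_cast; ring
    rw [e1, e2]; ring
  simp only [e]
  have h := DD_prod (j + r) (j + 1 + r) (by omega) (fun i => if i < j then a + b + i else a + b + c + d + i)
  have h' := DD_smul (j + 1 + r) ((Complex.Gamma (((j + 1 + r : ℕ) : ℂ) + a + b + c + d - 1))⁻¹) (fun k => ∏ i ∈ Finset.range (j + r),
        ((if i < j then a + b + i else a + b + c + d + i) + (k : ℂ)))
  rw [h, mul_zero] at h'
  exact h'

lemma poch_reflect (z : ℂ) (n : ℕ) : ∏ i ∈ Finset.range n, ((i : ℂ) - (n - 1) - z) = (-1) ^ n * pochC z n := by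
  rw [← Finset.prod_range_reflect]
  unfold pochC
  rw [← Finset.card_range n, ← Finset.prod_const, Finset.card_range, ← Finset.prod_mul_distrib]
  apply Finset.prod_congr rfl
  intro i hi
  have := Finset.mem_range.1 hi
  rw [Nat.sub_sub, Nat.cast_sub (by omega)]
  push_cast; ring

lemma sum_wco_eq {a b c d : ℂ} (ha : 0 < a.re) (hb : 0 < b.re) (hc : 0 < c.re) (hd : 0 < d.re) (n : ℕ) :
    4 * Real.pi * ∑ k ∈ Finset.range (n + 1), wco a b c d n k * GW (a + k) (b + n) c d = (-1) ^ n * KK a b c d n := by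
  rcases Nat.eq_zero_or_pos n with rfl | hn
  · simp [wco, KK, pochC, GW]
    ring
  have hab : 0 < (a + b).re := by simp; linarith
  have hac : 0 < (a + c).re := by simp; linarith
  have had : 0 < (a + d).re := by simp; linarith
  have hcd : 0 < (c + d).re := by simp; linarith
  simp only [wco_GW ha hb hc hd]
  rw [← Finset.mul_sum]
  obtain ⟨m, rfl⟩ := Nat.exists_eq_succ_of_ne_zero hn.ne'
  set z : ℂ := ((m.succ : ℕ) : ℂ) + a + b + c + d - 1 with hz
  have h0 : 0 < z.re := by simp [hz]; linarith [Nat.cast_nonneg (α := ℝ) m]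
  have g0 := Gamma_ne h0
  have e : ∀ k : ℕ, pochC (a + b + k) m.succ * (pochC z k / Complex.Gamma (a + b + c + d + m.succ + k)) =
      (Complex.Gamma z)⁻¹ * ((∏ i ∈ Finset.range m.succ, ((a + b + i) + (k : ℂ))) * (z + k)⁻¹) := by
    intro k
    have hzk : 0 < (z + k).re := by simp; positivity
    have g1 := Gamma_ne hzk
    have g2 := ne_zero_of_re hzk
    have q1 := Gamma_add_nat h0 k
    have g3 : pochC z k ≠ 0 := pochC_ne h0 k
    rw [show a + b + c + d + m.succ + k = z + k + 1 by rw [hz]; ring, Complex.Gamma_add_one _ g2, q1]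
    have : pochC (a + b + k) m.succ = ∏ i ∈ Finset.range m.succ, ((a + b + i) + (k : ℂ)) := by
      unfold pochC; apply Finset.prod_congr rfl; intros; ring
    rw [this]
    field_simp
  simp only [e]
  have h := DD_frac m.succ m.succ le_rfl (fun i => a + b + i) h0
  have h' := DD_smul m.succ (Complex.Gamma z)⁻¹ (fun k => (∏ i ∈ Finset.range m.succ, ((a + b + i) + (k : ℂ))) * (z + k)⁻¹)
  rw [h] at h'
  have h'' : ∑ i ∈ Finset.range (m.succ + 1),
      (-1 : ℂ) ^ i * (m.succ.choose i : ℂ) * ((Complex.Gamma z)⁻¹ * ((∏ i_1 ∈ Finset.range m.succ, (a + b + i_1 + (i:ℂ))) * (z + i)⁻¹)) = _ := h'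
  rw [h'']
  have e3 : ∏ i ∈ Finset.range m.succ, (a + b + i - z) = (-1) ^ m.succ * pochC (c + d) m.succ := by
    rw [← poch_reflect]
    apply Finset.prod_congr rfl
    intros; rw [hz]; ring
  rw [e3]
  unfold KK
  rw [Gamma_add_nat hab, Gamma_add_nat hcd, Gamma_add_nat hac, Gamma_add_nat had,
    show a + b + c + d + 2 * (m.succ : ℂ) = z + (m.succ + 1 : ℕ) by rw [hz]; push_cast; ring, Gamma_add_nat h0]
  exact alg2
end part6

section part7
open MeasureTheory Classical Complex Filter

lemma basis_change (α β : ℕ → ℂ) (k : ℕ) : ∃ co : ℕ → ℂ, ∀ X : ℂ,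
    ∏ i ∈ Finset.range k, (α i + X) = ∏ i ∈ Finset.range k, (β i + X) +
      ∑ j ∈ Finset.range k, co j * ∏ i ∈ Finset.range j, (β i + X) := by
  induction k with
  | zero => exact ⟨fun _ => 0, by simp⟩
  | succ k ih =>
    obtain ⟨co, h⟩ := ih
    let u : ℕ → ℂ := fun j => if j = k then α k - β k else co j * (α k - β j)
    let v : ℕ → ℂ := fun j => Nat.casesOn j 0 co
    refine ⟨fun j => u j + v j, fun X => ?_⟩
    have e1 : ∑ j ∈ Finset.range (k + 1), u j * ∏ i ∈ Finset.range j, (β i + X) =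
        ∑ j ∈ Finset.range k, co j * (α k - β j) * ∏ i ∈ Finset.range j, (β i + X) +
          (α k - β k) * ∏ i ∈ Finset.range k, (β i + X) := by
      rw [Finset.sum_range_succ]
      congr 1
      · apply Finset.sum_congr rfl
        intro j hj
        have : j ≠ k := (Finset.mem_range.1 hj).ne
        simp [u, this]
      · simp [u]
    have e2 : ∑ j ∈ Finset.range (k + 1), v j * ∏ i ∈ Finset.range j, (β i + X) =
        ∑ j ∈ Finset.range k, co j * ((∏ i ∈ Finset.range j, (β i + X)) * (β j + X)) := by
      rw [Finset.sum_range_succ']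
      simp [v, Finset.prod_range_succ]
    simp only [add_mul, Finset.sum_add_distrib]
    rw [e1, e2, Finset.prod_range_succ, h X, Finset.prod_range_succ, add_mul, Finset.sum_mul]
    have e3 : ∑ j ∈ Finset.range k, co j * (∏ i ∈ Finset.range j, (β i + X)) * (α k + X) =
      ∑ j ∈ Finset.range k, co j * (α k - β j) * ∏ i ∈ Finset.range j, (β i + X) +
      ∑ j ∈ Finset.range k, co j * ((∏ i ∈ Finset.range j, (β i + X)) * (β j + X)) := by
      rw [← Finset.sum_add_distrib]
      apply Finset.sum_congr rfl
      intros; ring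
    rw [e3]; ring

variable {a b c d : ℂ}

lemma int_b (ha : 0 < a.re) (hb : 0 < b.re) (hc : 0 < c.re) (hd : 0 < d.re) (n j : ℕ) (hj : j ≤ n) :
    Integrable (fun x => wilsonP a b c d n x * (phi b j x * wt a b c d x)) ∧
    ∫ x, wilsonP a b c d n x * (phi b j x * wt a b c d x) = if j = n then (-1) ^ n * KK a b c d n else 0 := by
  have e : (fun x => wilsonP a b c d n x * (phi b j x * wt a b c d x)) =
      fun x => ∑ k ∈ Finset.range (n + 1), wco a b c d n k * wt (a + k) (b + j) c d x := by
    ext x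
    rw [wilsonP_eq, Finset.sum_mul]
    apply Finset.sum_congr rfl
    intro k _
    rw [← phi_phi_wt ha hb]; ring
  have hak : ∀ k : ℕ, 0 < (a + k).re := fun k => by simp; positivity
  have hbj : 0 < (b + j).re := by simp; positivity
  have hi : ∀ k ∈ Finset.range (n + 1), Integrable (fun x => wco a b c d n k * wt (a + k) (b + j) c d x) := by
    intro k _
    exact (wt_integrable (hak k) hbj hc hd).const_mul _
  rw [e]
  refine ⟨integrable_finsetSum _ hi, ?_⟩
  rw [integral_finsetSum _ hi]
  have e2 : ∀ k ∈ Finset.range (n + 1), ∫ x, wco a b c d n k * wt (a + k) (b + j) c d x =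
      4 * Real.pi * (wco a b c d n k * GW (a + k) (b + j) c d) := by
    intro k _
    have := IW_eq (hak k) hbj hc hd
    rw [integral_const_mul]
    unfold IW at this
    rw [this]; ring
  rw [Finset.sum_congr rfl e2, ← Finset.mul_sum]
  split_ifs with h
  · subst h; exact sum_wco_eq ha hb hc hd j
  · rw [sum_wco_lt ha hb hc hd (by omega), mul_zero]

lemma int_a (ha : 0 < a.re) (hb : 0 < b.re) (hc : 0 < c.re) (hd : 0 < d.re) (n k : ℕ) (hk : k ≤ n) :
    Integrable (fun x => wilsonP a b c d n x * (phi a k x * wt a b c d x)) ∧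
    ∫ x, wilsonP a b c d n x * (phi a k x * wt a b c d x) = if k = n then (-1) ^ n * KK a b c d n else 0 := by
  obtain ⟨co, h⟩ := basis_change (fun i => (a + i) ^ 2) (fun i => (b + i) ^ 2) k
  have e : (fun x => wilsonP a b c d n x * (phi a k x * wt a b c d x)) =
      fun x => wilsonP a b c d n x * (phi b k x * wt a b c d x) +
        ∑ j ∈ Finset.range k, co j * (wilsonP a b c d n x * (phi b j x * wt a b c d x)) := by
    ext x
    have hx := h ((x : ℂ) ^ 2)
    have hx' : phi a k x = phi b k x + ∑ j ∈ Finset.range k, co j * phi b j x := hx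
    rw [hx', add_mul, mul_add, Finset.sum_mul, Finset.mul_sum]
    congr 1
    apply Finset.sum_congr rfl
    intros; ring
  have hi : ∀ j ∈ Finset.range k, Integrable (fun x => co j * (wilsonP a b c d n x * (phi b j x * wt a b c d x))) := by
    intro j hj
    have := Finset.mem_range.1 hj
    exact (int_b ha hb hc hd n j (by omega)).1.const_mul _
  have h0 := int_b ha hb hc hd n k hk
  rw [e]
  refine ⟨h0.1.add (integrable_finsetSum _ hi), ?_⟩
  rw [integral_add h0.1 (integrable_finsetSum _ hi), integral_finsetSum _ hi, h0.2, Finset.sum_eq_zero, add_zero]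
  intro j hj
  have := Finset.mem_range.1 hj
  rw [integral_const_mul, (int_b ha hb hc hd n j (by omega)).2, if_neg (by omega), mul_zero]

lemma wco_top (ha : 0 < a.re) (hb : 0 < b.re) (hc : 0 < c.re) (hd : 0 < d.re) (n : ℕ) :
    wco a b c d n n = (-1) ^ n * pochC (n + (a + b + c + d) - 1) n := by
  have h1 := pochC_ne (z := a + b) (by simp; linarith) n
  have h2 := pochC_ne (z := a + c) (by simp; linarith) n
  have h3 := pochC_ne (z := a + d) (by simp; linarith) n
  have h := poch_neg n n
  have hf : (n.factorial : ℂ) ≠ 0 := by exact_mod_cast n.factorial_ne_zero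
  rw [div_eq_iff hf] at h
  unfold wco
  rw [h, show (n + (a + b + c + d) - 1 : ℂ) = n + a + b + c + d - 1 by ring]
  simp
  field_simp

def HH (a b c d : ℂ) (n : ℕ) : ℂ := pochC (n + (a + b + c + d) - 1) n * KK a b c d n

lemma orth_le (ha : 0 < a.re) (hb : 0 < b.re) (hc : 0 < c.re) (hd : 0 < d.re) (n m : ℕ) (hm : m ≤ n) :
    ∫ x, wilsonP a b c d n x * wilsonP a b c d m x * wt a b c d x = if n = m then HH a b c d n else 0 := by
  have e : (fun x => wilsonP a b c d n x * wilsonP a b c d m x * wt a b c d x) =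
      fun x => ∑ k ∈ Finset.range (m + 1), wco a b c d m k * (wilsonP a b c d n x * (phi a k x * wt a b c d x)) := by
    ext x
    rw [wilsonP_eq a b c d m, Finset.mul_sum, Finset.sum_mul]
    apply Finset.sum_congr rfl
    intros; ring
  have hi : ∀ k ∈ Finset.range (m + 1), Integrable (fun x => wco a b c d m k * (wilsonP a b c d n x * (phi a k x * wt a b c d x))) := by
    intro k hk
    have := Finset.mem_range.1 hk
    exact (int_a ha hb hc hd n k (by omega)).1.const_mul _
  rw [e, integral_finsetSum _ hi]
  have e2 : ∀ k ∈ Finset.range (m + 1), ∫ x, wco a b c d m k * (wilsonP a b c d n x * (phi a k x * wt a b c d x)) =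
      if k = n then wco a b c d m k * ((-1) ^ n * KK a b c d n) else 0 := by
    intro k hk
    have := Finset.mem_range.1 hk
    rw [integral_const_mul, (int_a ha hb hc hd n k (by omega)).2, mul_ite, mul_zero]
  rw [Finset.sum_congr rfl e2]
  split_ifs with h
  · subst h
    rw [Finset.sum_ite_eq' (Finset.range (n + 1)) n, if_pos (by simp), wco_top ha hb hc hd, HH]
    have : ((-1 : ℂ) ^ n) * (-1) ^ n = 1 := by rw [← mul_pow]; simp
    linear_combination (pochC (n + (a + b + c + d) - 1) n * KK a b c d n) * this
  · apply Finset.sum_eq_zero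
    intro k hk
    have := Finset.mem_range.1 hk
    rw [if_neg (by omega)]

theorem orth_one (ha : 0 < a.re) (hb : 0 < b.re) (hc : 0 < c.re) (hd : 0 < d.re) (n m : ℕ) :
    ∫ x, wilsonP a b c d n x * wilsonP a b c d m x * wt a b c d x = if n = m then HH a b c d n else 0 := by
  rcases le_total m n with h | h
  · exact orth_le ha hb hc hd n m h
  · have := orth_le ha hb hc hd m n h
    simp only [mul_comm (wilsonP a b c d n _)]
    rw [this]
    by_cases hnm : n = m
    · subst hnm; simp
    · rw [if_neg hnm, if_neg (Ne.symm hnm)]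
end part7

section part8
open MeasureTheory Classical Complex Filter

section subexp
variable {X : Type*} {g : X → ℝ}

lemma SubExp.const (hg : ∀ x, 0 ≤ g x) (z : ℂ) : SubExp g (fun _ => z) :=
  SubExp.of_bounded hg (C := ‖z‖) (fun _ => le_rfl)

lemma SubExp.poch (hg : ∀ x, 0 ≤ g x) {f : X → ℂ} (hf : SubExp g f) (k : ℕ) : SubExp g (fun x => pochC (f x) k) := by
  unfold pochC
  exact SubExp.prod _ hg fun i _ => hf.add (SubExp.const hg _)

lemma SubExp.poch_inv (hg : ∀ x, 0 ≤ g x) {f : X → ℂ} {δ : ℝ} (hδ : 0 < δ) (hf : ∀ x, δ ≤ (f x).re) (k : ℕ) :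
    SubExp g (fun x => (pochC (f x) k)⁻¹) := by
  unfold pochC
  simp only [← Finset.prod_inv_distrib]
  refine SubExp.prod _ hg fun i _ => ?_
  refine SubExp.of_bounded hg (C := δ⁻¹) fun x => ?_
  rw [norm_inv]
  apply inv_anti₀ hδ
  refine le_trans ?_ (Complex.re_le_norm _)
  simp
  have := hf x
  have : (0:ℝ) ≤ i := Nat.cast_nonneg i
  linarith

lemma SubExp.wilson (hg : ∀ x, 0 ≤ g x) {a b : ℂ} (ha : 0 < a.re) (hb : 0 < b.re) {c d : X → ℂ} {t : X → ℝ}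
    (hc : SubExp g c) (hd : SubExp g d) (ht : SubExp g (fun x => (t x : ℂ))) (hc0 : ∀ x, 0 ≤ (c x).re) (hd0 : ∀ x, 0 ≤ (d x).re) (n : ℕ) :
    SubExp g (fun x => wilsonP a b (c x) (d x) n (t x)) := by
  have hcst := SubExp.const hg
  have hab : 0 < (a + b).re := by simp; linarith
  have hit : SubExp g (fun x => I * (t x : ℂ)) := (hcst I).mul ht
  have hit' : SubExp g (fun x => -(I * (t x : ℂ))) := hit.of_norm_le (fun x => by simp)
  have i1 : ∀ k, SubExp g (fun x => (pochC (a + b) k)⁻¹) := fun k => hcst _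
  have i2 : ∀ k, SubExp g (fun x => (pochC (a + c x) k)⁻¹) := fun k =>
    SubExp.poch_inv hg ha (fun x => by simp; exact hc0 x) k
  have i3 : ∀ k, SubExp g (fun x => (pochC (a + d x) k)⁻¹) := fun k =>
    SubExp.poch_inv hg ha (fun x => by simp; exact hd0 x) k
  have p2 : SubExp g (fun x => pochC (a + c x) n) := ((hcst a).add hc).poch hg n
  have p3 : SubExp g (fun x => pochC (a + d x) n) := ((hcst a).add hd).poch hg n
  have p4 : ∀ k, SubExp g (fun x => pochC ((n : ℂ) + a + b + c x + d x - 1) k) := fun k => by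
    simp only [sub_eq_add_neg]
    exact (((((hcst ((n : ℂ) + a + b))).add hc).add hd).add (hcst _)).poch hg k
  have p5 : ∀ k, SubExp g (fun x => pochC (a + I * t x) k) := fun k => ((hcst a).add hit).poch hg k
  have p6 : ∀ k, SubExp g (fun x => pochC (a - I * t x) k) := fun k => by
    simp only [sub_eq_add_neg]
    exact ((hcst a).add hit').poch hg k
  unfold wilsonP
  refine (((hcst _).mul p2).mul p3).mul (SubExp.sum _ hg fun k _ => ?_)
  simp only [div_eq_mul_inv, mul_inv]
  exact ((((hcst _).mul (p4 k)).mul (p5 k)).mul (p6 k)).mul ((((hcst _).mul (i1 k)).mul (i2 k)).mul (i3 k))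
end subexp

lemma Measurable.pochC {α : Type*} [MeasurableSpace α] {f : α → ℂ} (hf : Measurable f) (k : ℕ) :
    Measurable (fun x => _root_.pochC (f x) k) := by
  unfold _root_.pochC
  exact Finset.measurable_prod _ fun i _ => hf.add_const _

lemma Measurable.wilson {α : Type*} [MeasurableSpace α] {a b : ℂ} {c d : α → ℂ} {t : α → ℝ} (hc : Measurable c) (hd : Measurable d)
    (ht : Measurable t) (n : ℕ) : Measurable (fun x => wilsonP a b (c x) (d x) n (t x)) := by
  have hit : Measurable (fun x => I * (t x : ℂ)) := by fun_prop
  unfold wilsonP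
  refine Measurable.mul (((Measurable.pochC measurable_const n).mul ((hc.const_add a).pochC n)).mul ((hd.const_add a).pochC n)) ?_
  refine Finset.measurable_sum _ fun k _ => ?_
  refine Measurable.div ?_ ?_
  · refine ((measurable_const.mul ?_).mul ((hit.const_add a).pochC k)).mul ((measurable_const.sub hit).pochC k)
    exact (((hc.const_add _).add hd).sub_const _).pochC k
  · exact (measurable_const.mul ((hc.const_add a).pochC k)).mul ((hd.const_add a).pochC k)

/-- Zero-based recursive form of the multivariable Wilson polynomial. -/
def PW (c d : ℂ) : ℕ → ℂ → ℂ → (ℕ → ℂ) → (ℕ → ℕ) → (ℕ → ℝ) → ℂ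
  | 0, a, b, _, n, x => wilsonP a b c d (n 0) (x 0)
  | r + 1, a, b, p, n, x => wilsonP a b (p 0 + I * x 1) (p 0 - I * x 1) (n 0) (x 0) *
      PW c d r (a + p 0 + n 0) (b + p 0 + n 0) (fun k => p (k + 1)) (fun k => n (k + 1)) (fun k => x (k + 1))

/-- Zero-based recursive form of the weight without its first four Gamma factors. -/
def RW (c d : ℂ) : ℕ → (ℕ → ℂ) → (ℕ → ℝ) → ℂ
  | 0, _, x => gp c (x 0) * gp d (x 0) * Vw (x 0)
  | r + 1, p, x => gp (p 0 + I * x 1) (x 0) * gp (p 0 - I * x 1) (x 0) * Vw (x 0) *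
      RW c d r (fun k => p (k + 1)) (fun k => x (k + 1))

lemma measurable_shift : Measurable (fun (x : ℕ → ℝ) (k : ℕ) => x (k + 1)) := by
  exact measurable_pi_lambda _ fun k => measurable_pi_apply _

lemma measurable_PW (c d : ℂ) (r : ℕ) (a b : ℂ) (p : ℕ → ℂ) (n : ℕ → ℕ) : Measurable (PW c d r a b p n) := by
  induction r generalizing a b p n with
  | zero => exact Measurable.wilson measurable_const measurable_const (measurable_pi_apply 0) _
  | succ r ih =>
    refine Measurable.mul (Measurable.wilson ?_ ?_ (measurable_pi_apply 0) _) ((ih _ _ _ _).comp measurable_shift)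
    · fun_prop
    · fun_prop

lemma gp_gp (p : ℂ) (x y : ℝ) : gp (p + I * y) x * gp (p - I * y) x = gp p (x + y) * gp p (x - y) := by
  unfold gp
  rw [show p + I * y + I * x = p + I * (x + y : ℝ) by push_cast; ring,
    show p + I * y - I * x = p - I * (x - y : ℝ) by push_cast; ring,
    show p - I * y + I * x = p + I * (x - y : ℝ) by push_cast; ring,
    show p - I * y - I * x = p - I * (x + y : ℝ) by push_cast; ring]
  ring

lemma measurable_RW (c d : ℂ) (r : ℕ) (p : ℕ → ℂ) : Measurable (RW c d r p) := by
  induction r generalizing p with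
  | zero =>
    have : RW c d 0 p = fun x => gp c (x 0) * gp d (x 0) * Vw (x 0) := by ext x; rfl
    rw [this]
    fun_prop
  | succ r ih =>
    have : RW c d (r + 1) p = fun x => gp (p 0) (x 0 + x 1) * gp (p 0) (x 0 - x 1) * Vw (x 0) *
      RW c d r (fun k => p (k + 1)) (fun k => x (k + 1)) := by
      ext x; rw [← gp_gp]; rfl
    rw [this]
    refine Measurable.mul ?_ ((ih _).comp measurable_shift)
    fun_prop

lemma link_bound {a b a' b' p : ℂ} (ha : 0 < a.re) (hb : 0 < b.re) (ha' : 0 < a'.re) (hb' : 0 < b'.re) (hp : 0 < p.re) (n m : ℕ)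
    {ε : ℝ} (hε : 0 < ε) : ∃ C : ℝ, 0 ≤ C ∧ ∀ x y : ℝ,
    ‖wilsonP a b (p + I * y) (p - I * y) n x * wilsonP a' b' (p + I * y) (p - I * y) m x *
      (gp (p + I * y) x * gp (p - I * y) x * Vw x)‖ ≤
      C * Real.exp (ε * (|x| + |y|) - Real.pi * (|x + y| + |x - y|) + 2 * Real.pi * |x|) := by
  have hg : ∀ q : ℝ × ℝ, 0 ≤ |q.1| + |q.2| := fun q => by positivity
  have hx : SubExp (fun q : ℝ × ℝ => |q.1| + |q.2|) (fun q => (q.1 : ℂ)) :=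
    SubExp.of_linear hg (C := 0) (D := 1) (fun q => by simp)
  have hy : SubExp (fun q : ℝ × ℝ => |q.1| + |q.2|) (fun q => p + I * q.2) :=
    SubExp.of_linear hg (C := ‖p‖) (D := 1) (fun q => (norm_add_le _ _).trans (by simp))
  have hy' : SubExp (fun q : ℝ × ℝ => |q.1| + |q.2|) (fun q => p - I * q.2) :=
    SubExp.of_linear hg (C := ‖p‖) (D := 1) (fun q => (norm_sub_le _ _).trans (by simp))
  have w1 := SubExp.wilson hg ha hb hy hy' hx (fun q => by simpa using hp.le) (fun q => by simpa using hp.le) n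
  have w2 := SubExp.wilson hg ha' hb' hy hy' hx (fun q => by simpa using hp.le) (fun q => by simpa using hp.le) m
  have g1 := ((gp_line hp).comp (fun q : ℝ × ℝ => q.1 + q.2)).mono (g' := fun q : ℝ × ℝ => |q.1| + |q.2|) (A := 0) (B := 1)
    zero_le_one (fun q => by simpa using abs_add_le q.1 q.2) hg
  have g2 := ((gp_line hp).comp (fun q : ℝ × ℝ => q.1 - q.2)).mono (g' := fun q : ℝ × ℝ => |q.1| + |q.2|) (A := 0) (B := 1)
    zero_le_one (fun q => by simpa using abs_sub q.1 q.2) hg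
  have v := (Vw_line.comp (fun q : ℝ × ℝ => q.1)).mono (g' := fun q : ℝ × ℝ => |q.1| + |q.2|) (A := 0) (B := 1)
    zero_le_one (fun q => by simp) hg
  obtain ⟨C, hC, h⟩ := ((w1.mul w2).mul ((g1.mul g2).mul v)) ε hε
  refine ⟨C, hC, fun x y => ?_⟩
  have h := h (x, y)
  rw [gp_gp]
  simp only [norm_mul, Complex.norm_real, Real.norm_of_nonneg (Real.exp_pos _).le] at h ⊢
  set W1 := ‖wilsonP a b (p + I * y) (p - I * y) n x‖
  set W2 := ‖wilsonP a' b' (p + I * y) (p - I * y) m x‖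
  set G1 := ‖gp p (x + y)‖
  set G2 := ‖gp p (x - y)‖
  set VV := ‖Vw x‖
  have e : W1 * W2 * (G1 * G2 * VV) = W1 * W2 * (G1 * Real.exp (Real.pi * |x + y|) * (G2 * Real.exp (Real.pi * |x - y|)) *
      (VV * Real.exp (-(2 * Real.pi) * |x|))) * Real.exp (- Real.pi * (|x + y| + |x - y|) + 2 * Real.pi * |x|) := by
    have : Real.exp (Real.pi * |x + y|) * Real.exp (Real.pi * |x - y|) * Real.exp (-(2 * Real.pi) * |x|) *
       Real.exp (- Real.pi * (|x + y| + |x - y|) + 2 * Real.pi * |x|) = 1 := by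
      simp only [← Real.exp_add]
      rw [Real.exp_eq_one_iff]; ring
    linear_combination (-(W1 * W2 * (G1 * G2 * VV))) * this
  rw [e]
  calc _ ≤ C * Real.exp (ε * (|x| + |y|)) * Real.exp (- Real.pi * (|x + y| + |x - y|) + 2 * Real.pi * |x|) := by gcongr
    _ = _ := by rw [mul_assoc, ← Real.exp_add]; congr 2; ring

lemma abs_max (x y : ℝ) : |x + y| + |x - y| = 2 * max |x| |y| := by
  rcases abs_cases x with ⟨h1, _⟩ | ⟨h1, _⟩ <;> rcases abs_cases y with ⟨h2, _⟩ | ⟨h2, _⟩ <;>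
  rcases abs_cases (x + y) with ⟨h3, _⟩ | ⟨h3, _⟩ <;> rcases abs_cases (x - y) with ⟨h4, _⟩ | ⟨h4, _⟩ <;>
  rcases max_cases |x| |y| with ⟨h5, _⟩ | ⟨h5, _⟩ <;> rw [h5] <;> linarith

lemma T_bound {c d : ℂ} (hc : 0 < c.re) (hd : 0 < d.re) (r : ℕ) {a b a' b' : ℂ} {p : ℕ → ℂ} (n m : ℕ → ℕ)
    (ha : 0 < a.re) (hb : 0 < b.re) (ha' : 0 < a'.re) (hb' : 0 < b'.re) (hp : ∀ k < r, 0 < (p k).re) :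
    ∃ C δ : ℝ, 0 ≤ C ∧ 0 < δ ∧ δ ≤ 1 ∧ ∀ x : ℕ → ℝ, ‖PW c d r a b p n x * PW c d r a' b' p m x * RW c d r p x‖ ≤
      C * Real.exp (2 * Real.pi * |x 0| - δ * ∑ k ∈ Finset.range (r + 1), |x k|) := by
  induction r generalizing a b a' b' p n m with
  | zero =>
    have hg : ∀ q : ℝ, 0 ≤ |q| := fun q => by positivity
    have hx : SubExp (fun q : ℝ => |q|) (fun q => (q : ℂ)) :=
      SubExp.of_linear hg (C := 0) (D := 1) (fun q => by simp)
    have w1 := SubExp.wilson hg ha hb (SubExp.const hg c) (SubExp.const hg d) hx (fun _ => hc.le) (fun _ => hd.le) (n 0)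
    have w2 := SubExp.wilson hg ha' hb' (SubExp.const hg c) (SubExp.const hg d) hx (fun _ => hc.le) (fun _ => hd.le) (m 0)
    obtain ⟨C, hC, h⟩ := ((w1.mul w2).mul (((gp_line hc).mul (gp_line hd)).mul Vw_line)) (2 * Real.pi - 1) (by linarith [Real.pi_gt_three])
    refine ⟨C, 1, hC, one_pos, le_rfl, fun x => ?_⟩
    have h := h (x 0)
    simp only [PW, RW, zero_add, Finset.range_one, Finset.sum_singleton]
    rw [show 2 * Real.pi * |x 0| - 1 * |x 0| = (2 * Real.pi - 1) * |x 0| by ring]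
    refine le_trans (le_of_eq ?_) h
    have : Real.exp (Real.pi * |x 0|) * Real.exp (Real.pi * |x 0|) * Real.exp (-(2 * Real.pi) * |x 0|) = 1 := by
      simp only [← Real.exp_add]
      rw [Real.exp_eq_one_iff]; ring
    simp only [norm_mul, Complex.norm_real, Real.norm_of_nonneg (Real.exp_pos _).le]
    linear_combination (-(‖wilsonP a b c d (n 0) (x 0)‖ * ‖wilsonP a' b' c d (m 0) (x 0)‖ * (‖gp c (x 0)‖ * ‖gp d (x 0)‖ * ‖Vw (x 0)‖))) * this
  | succ r ih =>
    have hp0 := hp 0 (by omega)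
    have hpos : ∀ (z : ℂ) (k : ℕ), 0 < z.re → 0 < (z + p 0 + k).re := by
      intro z k hz; simp; positivity
    obtain ⟨C, δ, hC, hδ, hδ1, h⟩ := ih (p := fun k => p (k + 1)) (fun k => n (k + 1)) (fun k => m (k + 1)) (hpos a (n 0) ha)
      (hpos b (n 0) hb) (hpos a' (m 0) ha') (hpos b' (m 0) hb') (fun k hk => hp _ (by omega))
    obtain ⟨C', hC', h'⟩ := link_bound ha hb ha' hb' hp0 (n 0) (m 0) (ε := δ / 8) (by positivity)
    refine ⟨C' * C, δ / 4, by positivity, by positivity, by linarith, fun x => ?_⟩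
    have h1 := h (fun k => x (k + 1))
    have h2 := h' (x 0) (x 1)
    have e : PW c d (r + 1) a b p n x * PW c d (r + 1) a' b' p m x * RW c d (r + 1) p x =
      (wilsonP a b (p 0 + I * x 1) (p 0 - I * x 1) (n 0) (x 0) * wilsonP a' b' (p 0 + I * x 1) (p 0 - I * x 1) (m 0) (x 0) *
      (gp (p 0 + I * x 1) (x 0) * gp (p 0 - I * x 1) (x 0) * Vw (x 0))) *
      (PW c d r (a + p 0 + n 0) (b + p 0 + n 0) (fun k => p (k + 1)) (fun k => n (k + 1)) (fun k => x (k + 1)) *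
      PW c d r (a' + p 0 + m 0) (b' + p 0 + m 0) (fun k => p (k + 1)) (fun k => m (k + 1)) (fun k => x (k + 1)) *
      RW c d r (fun k => p (k + 1)) (fun k => x (k + 1))) := by
      simp only [PW, RW]; ring
    rw [e, norm_mul]
    calc _ ≤ (C' * Real.exp (δ / 8 * (|x 0| + |x 1|) - Real.pi * (|x 0 + x 1| + |x 0 - x 1|) + 2 * Real.pi * |x 0|)) *
        (C * Real.exp (2 * Real.pi * |x (0 + 1)| - δ * ∑ k ∈ Finset.range (r + 1), |x (k + 1)|)) := by gcongr
      _ = C' * C * Real.exp ((δ / 8 * (|x 0| + |x 1|) - Real.pi * (|x 0 + x 1| + |x 0 - x 1|) + 2 * Real.pi * |x 0|) +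
         (2 * Real.pi * |x (0 + 1)| - δ * ∑ k ∈ Finset.range (r + 1), |x (k + 1)|)) := by
        rw [mul_mul_mul_comm, ← Real.exp_add]
      _ ≤ _ := by
        gcongr
        rw [abs_max, Finset.sum_range_succ' (fun k => |x k|) (r + 1)]
        rw [Finset.sum_range_succ' (fun k => |x (k + 1)|) r]
        have hS : 0 ≤ ∑ k ∈ Finset.range r, |x (k + 1 + 1)| := Finset.sum_nonneg fun _ _ => abs_nonneg _
        have hpi := Real.pi_gt_three
        have hx0 := abs_nonneg (x 0)
        have hx1 := abs_nonneg (x 1)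
        simp only [zero_add]
        generalize ∑ k ∈ Finset.range r, |x (k + 1 + 1)| = S at *
        generalize |x 0| = u at *
        generalize |x 1| = v at *
        rcases max_cases u v with ⟨h5, h6⟩ | ⟨h5, h6⟩ <;> rw [h5]
        · nlinarith [mul_nonneg hδ.le hS, mul_nonneg hδ.le hx1, mul_nonneg (sub_nonneg.2 h6) (by linarith : 0 ≤ Real.pi - 3),
            mul_nonneg (sub_nonneg.2 h6) (sub_nonneg.2 hδ1)]
        · nlinarith [mul_nonneg hδ.le hS, mul_nonneg hδ.le hx1, mul_nonneg (sub_nonneg.2 h6.le) hδ.le]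
end part8

section part9
open MeasureTheory Classical Complex Filter

/-- Zero-based extension of a finite vector by zero. -/
def ext0 (s : ℕ) (y : Fin s → ℝ) (k : ℕ) : ℝ := if h : k < s then y ⟨k, h⟩ else 0

lemma ext0_cons_zero (s : ℕ) (t : ℝ) (y : Fin s → ℝ) : ext0 (s + 1) (Fin.cons t y) 0 = t := by
  simp only [ext0, Nat.zero_lt_succ, dif_pos]
  rfl

lemma ext0_cons_succ (s : ℕ) (t : ℝ) (y : Fin s → ℝ) (k : ℕ) : ext0 (s + 1) (Fin.cons t y) (k + 1) = ext0 s y k := by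
  simp only [ext0, Nat.add_lt_add_iff_right]
  split_ifs with h
  · exact Fin.cons_succ (α := fun _ => ℝ) t y ⟨k, h⟩
  · rfl

lemma measurable_ext0 (s : ℕ) : Measurable (ext0 s) := by
  refine measurable_pi_lambda _ fun k => ?_
  unfold ext0
  split_ifs with h
  · exact measurable_pi_apply _
  · exact measurable_const

/-- The full integrand. -/
def FW (c d : ℂ) (r : ℕ) (a b : ℂ) (p : ℕ → ℂ) (n m : ℕ → ℕ) (x : ℕ → ℝ) : ℂ :=
  PW c d r a b p n x * PW c d r a b p m x * (gp a (x 0) * gp b (x 0) * RW c d r p x)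

lemma integrable_FW {c d : ℂ} (hc : 0 < c.re) (hd : 0 < d.re) (r : ℕ) {a b : ℂ} {p : ℕ → ℂ} (n m : ℕ → ℕ)
    (ha : 0 < a.re) (hb : 0 < b.re) (hp : ∀ k < r, 0 < (p k).re) :
    Integrable (fun y : Fin (r + 1) → ℝ => FW c d r a b p n m (ext0 (r + 1) y)) := by
  obtain ⟨C, δ, hC, hδ, hδ1, h⟩ := T_bound hc hd r n m ha hb ha hb hp
  obtain ⟨C1, hC1, h1⟩ := SubExp.bound (f := fun t => gp a t) (gp_line ha) (c := Real.pi - δ / 4) (by linarith)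
  obtain ⟨C2, hC2, h2⟩ := SubExp.bound (f := fun t => gp b t) (gp_line hb) (c := Real.pi - δ / 4) (by linarith)
  have hI : Integrable (fun y : Fin (r + 1) → ℝ => C * C1 * C2 * ∏ i, Real.exp (-(δ / 2) * |y i|)) := by
    refine Integrable.const_mul ?_ _
    exact Integrable.fintype_prod (f := fun _ t => Real.exp (-(δ / 2) * |t|)) fun i => integrable_exp_neg_abs (by positivity)
  refine hI.mono' ?_ (Eventually.of_forall fun y => ?_)
  · refine Measurable.aestronglyMeasurable ?_
    have hm : Measurable (FW c d r a b p n m) := by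
      unfold FW
      have m1 := measurable_PW c d r a b p n
      have m2 := measurable_PW c d r a b p m
      have m3 := measurable_RW c d r p
      fun_prop
    exact hm.comp (measurable_ext0 _)
  · set x := ext0 (r + 1) y with hx
    have hsum : ∑ k ∈ Finset.range (r + 1), |x k| = ∑ i : Fin (r + 1), |y i| := by
      rw [Finset.sum_range]
      refine Finset.sum_congr rfl fun i _ => ?_
      rw [hx, ext0, dif_pos i.2]
    have h0 : |x 0| ≤ ∑ i : Fin (r + 1), |y i| := by
      rw [← hsum]
      exact Finset.single_le_sum (f := fun k => |x k|) (fun _ _ => abs_nonneg _) (by simp)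
    have hh := h x
    rw [hsum] at hh
    rw [← Real.exp_sum, ← Finset.mul_sum]
    have e : FW c d r a b p n m x = PW c d r a b p n x * PW c d r a b p m x * RW c d r p x * gp a (x 0) * gp b (x 0) := by
      unfold FW; ring
    rw [e, norm_mul, norm_mul]
    calc _ ≤ (C * Real.exp (2 * Real.pi * |x 0| - δ * ∑ i, |y i|)) * (C1 * Real.exp (-(Real.pi - δ / 4) * |x 0|)) *
          (C2 * Real.exp (-(Real.pi - δ / 4) * |x 0|)) := by
          gcongr
          · exact h1 _
          · exact h2 _
      _ = C * C1 * C2 * Real.exp (δ / 2 * |x 0| - δ * ∑ i, |y i|) := by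
          rw [mul_mul_mul_comm C, ← Real.exp_add, mul_mul_mul_comm (C * C1), ← Real.exp_add]
          congr 2; ring
      _ ≤ _ := by
          gcongr
          nlinarith

/-- One-step constant. -/
def L1 (a b p : ℂ) (n : ℕ) : ℂ := 4 * Real.pi * (n.factorial * pochC (n + (a + b + 2 * p) - 1) n *
  Complex.Gamma (a + b + n) * Complex.Gamma (2 * p + n) / Complex.Gamma (a + b + 2 * p + 2 * n))

/-- Recursive normalization. -/
def LAM (c d : ℂ) : ℕ → ℂ → ℂ → (ℕ → ℂ) → (ℕ → ℕ) → ℂ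
  | 0, a, b, _, n => HH a b c d (n 0)
  | r + 1, a, b, p, n => L1 a b (p 0) (n 0) *
      LAM c d r (a + p 0 + n 0) (b + p 0 + n 0) (fun k => p (k + 1)) (fun k => n (k + 1))

lemma HH_link (a b p : ℂ) (n : ℕ) (y : ℝ) : HH a b (p + I * y) (p - I * y) n =
    L1 a b p n * (gp (a + p + n) y * gp (b + p + n) y) := by
  unfold HH KK L1 gp
  rw [show a + b + (p + I * y) + (p - I * y) = a + b + 2 * p by ring,
    show p + I * y + (p - I * y) + n = 2 * p + n by ring,
    show a + (p + I * y) + n = a + p + n + I * y by ring,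
    show a + (p - I * y) + n = a + p + n - I * y by ring,
    show b + (p + I * y) + n = b + p + n + I * y by ring,
    show b + (p - I * y) + n = b + p + n - I * y by ring]
  ring

lemma integral_cons (s : ℕ) (f : (Fin (s + 1) → ℝ) → ℂ) (hf : Integrable f) :
    ∫ y, f y = ∫ y : Fin s → ℝ, ∫ t : ℝ, f (Fin.cons t y) := by
  have hmp := (volume_preserving_piFinSuccAbove (fun _ : Fin (s + 1) => ℝ) 0).symm
  have e : ∀ z : ℝ × (Fin s → ℝ), (MeasurableEquiv.piFinSuccAbove (fun _ : Fin (s + 1) => ℝ) 0).symm z = Fin.cons z.1 z.2 := by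
    intro z
    simp [MeasurableEquiv.piFinSuccAbove_symm_apply, Fin.insertNthEquiv]
  rw [← hmp.integral_comp']
  simp only [e]
  refine integral_prod_symm (fun z : ℝ × (Fin s → ℝ) => f (Fin.cons z.1 z.2)) ?_
  have := (hmp.integrable_comp_emb (MeasurableEquiv.measurableEmbedding _)).2 hf
  refine this.congr (Eventually.of_forall fun z => ?_)
  simp only [Function.comp, e]

lemma main_int {c d : ℂ} (hc : 0 < c.re) (hd : 0 < d.re) (r : ℕ) {a b : ℂ} {p : ℕ → ℂ} (n m : ℕ → ℕ)
    (ha : 0 < a.re) (hb : 0 < b.re) (hp : ∀ k < r, 0 < (p k).re) :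
    ∫ y : Fin (r + 1) → ℝ, FW c d r a b p n m (ext0 (r + 1) y) =
      if ∀ k < r + 1, n k = m k then LAM c d r a b p n else 0 := by
  rw [integral_cons _ _ (integrable_FW hc hd r n m ha hb hp)]
  induction r generalizing a b p n m with
  | zero =>
    simp only [FW, PW, RW, ext0_cons_zero, LAM]
    have := orth_one ha hb hc hd (n 0) (m 0)
    have e : ∀ t, wilsonP a b c d (n 0) t * wilsonP a b c d (m 0) t * (gp a t * gp b t * (gp c t * gp d t * Vw t)) =
      wilsonP a b c d (n 0) t * wilsonP a b c d (m 0) t * wt a b c d t := fun t => by unfold wt; ring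
    simp only [e, this]
    have hv : (volume : Measure (Fin 0 → ℝ)).real Set.univ = 1 := by simp [measureReal_def, volume_pi]
    simp [hv]
  | succ r ih =>
    have hp0 := hp 0 (by omega)
    have hpos : ∀ (z : ℂ) (k : ℕ), 0 < z.re → 0 < (z + p 0 + k).re := by
      intro z k hz; simp; positivity
    have inner : ∀ y : Fin (r + 1) → ℝ, ∫ t : ℝ, FW c d (r + 1) a b p n m (ext0 (r + 1 + 1) (Fin.cons t y)) =
        if n 0 = m 0 then L1 a b (p 0) (n 0) * FW c d r (a + p 0 + n 0) (b + p 0 + n 0) (fun k => p (k + 1))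
          (fun k => n (k + 1)) (fun k => m (k + 1)) (ext0 (r + 1) y) else 0 := by
      intro y
      simp only [FW, PW, RW, ext0_cons_zero, ext0_cons_succ]
      have e1 : ∀ t, ext0 (r + 1 + 1) (Fin.cons t y) 1 = ext0 (r + 1) y 0 := fun t => ext0_cons_succ _ t y 0
      try simp only [e1]
      set x1 := ext0 (r + 1) y 0
      have hq : 0 < (p 0 + I * x1).re := by simpa using hp0
      have hq' : 0 < (p 0 - I * x1).re := by simpa using hp0
      have := orth_one ha hb hq hq' (n 0) (m 0)
      set Q1 := PW c d r (a + p 0 + n 0) (b + p 0 + n 0) (fun k => p (k + 1)) (fun k => n (k + 1)) (fun k => ext0 (r + 1) y k) with hQ1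
      set Q2 := PW c d r (a + p 0 + m 0) (b + p 0 + m 0) (fun k => p (k + 1)) (fun k => m (k + 1)) (fun k => ext0 (r + 1) y k) with hQ2
      set Q3 := RW c d r (fun k => p (k + 1)) (fun k => ext0 (r + 1) y k) with hQ3
      have e : ∀ t : ℝ, wilsonP a b (p 0 + I * x1) (p 0 - I * x1) (n 0) t * Q1 *
         (wilsonP a b (p 0 + I * x1) (p 0 - I * x1) (m 0) t * Q2) * (gp a t * gp b t *
         (gp (p 0 + I * x1) t * gp (p 0 - I * x1) t * Vw t * Q3)) = 
         (wilsonP a b (p 0 + I * x1) (p 0 - I * x1) (n 0) t * wilsonP a b (p 0 + I * x1) (p 0 - I * x1) (m 0) t *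
          wt a b (p 0 + I * x1) (p 0 - I * x1) t) * (Q1 * Q2 * Q3) := fun t => by unfold wt; ring
      simp only [e]
      rw [integral_mul_const, this]
      split_ifs with h
      · rw [HH_link, hQ2, ← h]; ring
      · simp
    simp only [inner]
    by_cases h : n 0 = m 0
    · simp only [h, if_true]
      rw [integral_const_mul, integral_cons _ _ (integrable_FW hc hd r _ _ (hpos a _ ha) (hpos b _ hb) (fun k hk => hp _ (by omega))),
        ih _ _ (hpos a _ ha) (hpos b _ hb) (fun k hk => hp _ (by omega))]
      have iff1 : (∀ k < r + 1 + 1, n k = m k) ↔ ∀ k < r + 1, n (k + 1) = m (k + 1) := by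
        constructor
        · intro H k hk; exact H _ (by omega)
        · intro H k hk
          rcases k with _ | k
          · exact h
          · exact H k (by omega)
      simp only [iff1, mul_ite, mul_zero, LAM, h]
    · simp only [h, if_false, integral_zero]
      rw [if_neg]
      intro H; exact h (H 0 (by omega))
end part9

section part10
open MeasureTheory Classical Complex

lemma prod_Icc_one (f : ℕ → ℂ) (r : ℕ) : ∏ k ∈ Finset.Icc 1 r, f k = ∏ k ∈ Finset.range r, f (k + 1) := by
  induction r with
  | zero => simp
  | succ r ih => rw [Finset.prod_Icc_succ_top (by omega), ih, Finset.prod_range_succ]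

lemma sum_Icc_two (f : ℕ → ℂ) (r : ℕ) : ∑ k ∈ Finset.Icc 2 (r + 1), f k = ∑ k ∈ Finset.range r, f (k + 2) := by
  induction r with
  | zero => simp
  | succ r ih => rw [Finset.sum_Icc_succ_top (by omega), ih, Finset.sum_range_succ]

lemma psum_cast (n : ℕ → ℕ) (r : ℕ) : (psum n 1 r : ℂ) = ∑ k ∈ Finset.range r, (n (k + 1) : ℂ) := by
  unfold psum
  induction r with
  | zero => simp
  | succ r ih => rw [Finset.sum_Icc_succ_top (by omega), Nat.cast_add, ih, Finset.sum_range_succ]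

lemma alphaS_two (a b c d : ℂ) (ap : ℕ → ℂ) {r k : ℕ} (hk : k ≤ r) :
    alphaS a b c d ap (r + 1) 2 (k + 1) = ∑ i ∈ Finset.range k, ap (i + 2) := by
  unfold alphaS
  rw [sum_Icc_two]
  refine Finset.sum_congr rfl fun i hi => ?_
  have := Finset.mem_range.1 hi
  unfold apEx
  rw [if_neg (by omega), if_neg (by omega)]

lemma alphaS_one (a b c d : ℂ) (ap : ℕ → ℂ) {r k : ℕ} (hk : k ≤ r) :
    2 * alphaS a b c d ap (r + 1) 1 (k + 1) = a + b + 2 * ∑ i ∈ Finset.range k, ap (i + 2) := by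
  rw [← alphaS_two a b c d ap hk]
  unfold alphaS
  rw [← Finset.insert_Icc_succ_left_eq_Icc (by omega : 1 ≤ k + 1), Finset.sum_insert (by simp)]
  have : apEx a b c d ap (r + 1) 1 = (a + b) / 2 := by simp [apEx]
  rw [this]
  simp only [Order.succ_eq_add_one, Nat.reduceAdd]
  ring

lemma alphaS_last (a b c d : ℂ) (ap : ℕ → ℂ) (r : ℕ) :
    2 * alphaS a b c d ap (r + 1) 1 (r + 1 + 1) = a + b + 2 * (∑ i ∈ Finset.range r, ap (i + 2)) + (c + d) := by
  rw [← alphaS_one a b c d ap le_rfl]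
  unfold alphaS
  rw [Finset.sum_Icc_succ_top (by omega)]
  have : apEx a b c d ap (r + 1) (r + 1 + 1) = (c + d) / 2 := by
    unfold apEx
    rw [if_neg (by omega), if_pos rfl]
  rw [this]; ring

lemma PW_closed (c d : ℂ) (r : ℕ) (a b : ℂ) (p : ℕ → ℂ) (n : ℕ → ℕ) (x : ℕ → ℝ) : PW c d r a b p n x =
    (∏ k ∈ Finset.range r, wilsonP (a + ∑ i ∈ Finset.range k, p i + ∑ i ∈ Finset.range k, (n i : ℂ))
      (b + ∑ i ∈ Finset.range k, p i + ∑ i ∈ Finset.range k, (n i : ℂ)) (p k + I * x (k + 1)) (p k - I * x (k + 1)) (n k) (x k)) *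
    wilsonP (a + ∑ i ∈ Finset.range r, p i + ∑ i ∈ Finset.range r, (n i : ℂ))
      (b + ∑ i ∈ Finset.range r, p i + ∑ i ∈ Finset.range r, (n i : ℂ)) c d (n r) (x r) := by
  induction r generalizing a b p n x with
  | zero => simp [PW]
  | succ r ih =>
    have e : ∀ (z : ℂ) (k : ℕ), z + p 0 + n 0 + ∑ i ∈ Finset.range k, p (i + 1) + ∑ i ∈ Finset.range k, (n (i + 1) : ℂ) =
      z + ∑ i ∈ Finset.range (k + 1), p i + ∑ i ∈ Finset.range (k + 1), (n i : ℂ) := by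
      intro z k
      rw [Finset.sum_range_succ', Finset.sum_range_succ']; ring
    rw [PW, ih, Finset.prod_range_succ']
    simp only [e, Finset.range_zero, Finset.sum_empty, add_zero, zero_add]
    ring

lemma RW_closed (c d : ℂ) (r : ℕ) (p : ℕ → ℂ) (x : ℕ → ℝ) : RW c d r p x =
    (∏ k ∈ Finset.range r, (gp (p k + I * x (k + 1)) (x k) * gp (p k - I * x (k + 1)) (x k) * Vw (x k))) *
    (gp c (x r) * gp d (x r) * Vw (x r)) := by
  induction r generalizing p x with
  | zero => simp [RW]
  | succ r ih =>
    rw [RW, ih, Finset.prod_range_succ']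
    simp only [zero_add]
    ring

lemma LAM_closed (c d : ℂ) (r : ℕ) (a b : ℂ) (p : ℕ → ℂ) (n : ℕ → ℕ) : LAM c d r a b p n =
    (∏ k ∈ Finset.range r, L1 (a + ∑ i ∈ Finset.range k, p i + ∑ i ∈ Finset.range k, (n i : ℂ))
      (b + ∑ i ∈ Finset.range k, p i + ∑ i ∈ Finset.range k, (n i : ℂ)) (p k) (n k)) *
    HH (a + ∑ i ∈ Finset.range r, p i + ∑ i ∈ Finset.range r, (n i : ℂ))
      (b + ∑ i ∈ Finset.range r, p i + ∑ i ∈ Finset.range r, (n i : ℂ)) c d (n r) := by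
  induction r generalizing a b p n with
  | zero => simp [LAM]
  | succ r ih =>
    have e : ∀ (z : ℂ) (k : ℕ), z + p 0 + n 0 + ∑ i ∈ Finset.range k, p (i + 1) + ∑ i ∈ Finset.range k, (n (i + 1) : ℂ) =
      z + ∑ i ∈ Finset.range (k + 1), p i + ∑ i ∈ Finset.range (k + 1), (n i : ℂ) := by
      intro z k
      rw [Finset.sum_range_succ', Finset.sum_range_succ']; ring
    rw [LAM, ih, Finset.prod_range_succ']
    simp only [e, Finset.range_zero, Finset.sum_empty, add_zero]
    ring

lemma mvWilson_eq (a b c d : ℂ) (ap : ℕ → ℂ) (r : ℕ) (n : ℕ → ℕ) (x : ℕ → ℝ) : mvWilson a b c d ap (r + 1) n x =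
    PW c d r a b (fun k => ap (k + 2)) (fun k => n (k + 1)) (fun k => x (k + 1)) := by
  rw [PW_closed]
  unfold mvWilson
  rw [Nat.add_sub_cancel, prod_Icc_one, psum_cast, alphaS_two a b c d ap le_rfl]
  congr 1
  refine Finset.prod_congr rfl fun k hk => ?_
  have := Finset.mem_range.1 hk
  rw [Nat.add_sub_cancel, alphaS_two a b c d ap this.le, psum_cast]

lemma wilsonRho_eq (a b c d : ℂ) (ap : ℕ → ℂ) (r : ℕ) (x : ℕ → ℝ) : wilsonRho a b c d ap (r + 1) x =
    gp a (x 1) * gp b (x 1) * RW c d r (fun k => ap (k + 2)) (fun k => x (k + 1)) := by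
  rw [RW_closed]
  unfold wilsonRho
  rw [Nat.add_sub_cancel, prod_Icc_one, mul_assoc]
  congr 1
  · unfold gp; ring
  · congr 1
    · refine Finset.prod_congr rfl fun k hk => ?_
      unfold gp Vw
      rw [div_eq_mul_inv]
      ring_nf
    · unfold gp Vw
      rw [div_eq_mul_inv]
      ring

lemma lamW_eq (a b c d : ℂ) (ap : ℕ → ℂ) (r : ℕ) (n : ℕ → ℕ) : lamW a b c d ap (r + 1) n =
    LAM c d r a b (fun k => ap (k + 2)) (fun k => n (k + 1)) := by
  rw [LAM_closed]
  unfold lamW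
  rw [prod_Icc_one, Finset.prod_range_succ]
  simp only [Nat.add_sub_cancel]
  have hE : apEx a b c d ap (r + 1) (r + 1 + 1) = (c + d) / 2 := by
    unfold apEx
    rw [if_neg (by omega), if_pos rfl]
  have hprod : ((4 * Real.pi : ℝ) : ℂ) ^ r * ∏ k ∈ Finset.range r, ((Nat.factorial (n (k + 1)) : ℂ) *
          pochC ((psum n 1 (k + 1) : ℂ) + psum n 1 k + 2 * alphaS a b c d ap (r + 1) 1 (k + 1 + 1) - 1)
            (n (k + 1)) *
          Complex.Gamma ((psum n 1 (k + 1) : ℂ) + psum n 1 k + 2 * alphaS a b c d ap (r + 1) 1 (k + 1)) *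
          Complex.Gamma ((n (k + 1) : ℂ) + 2 * apEx a b c d ap (r + 1) (k + 1 + 1)) /
        Complex.Gamma (2 * (psum n 1 (k + 1) : ℂ) + 2 * alphaS a b c d ap (r + 1) 1 (k + 1 + 1))) =
      ∏ k ∈ Finset.range r, L1 (a + ∑ i ∈ Finset.range k, ap (i + 2) + ∑ i ∈ Finset.range k, (n (i + 1) : ℂ))
      (b + ∑ i ∈ Finset.range k, ap (i + 2) + ∑ i ∈ Finset.range k, (n (i + 1) : ℂ)) (ap (k + 2)) (n (k + 1)) := by
    have : ((4 * Real.pi : ℝ) : ℂ) ^ r = ∏ k ∈ Finset.range r, ((4 * Real.pi : ℝ) : ℂ) := by simp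
    rw [this, ← Finset.prod_mul_distrib]
    refine Finset.prod_congr rfl fun k hk => ?_
    have hk := Finset.mem_range.1 hk
    have hE' : apEx a b c d ap (r + 1) (k + 1 + 1) = ap (k + 2) := by
      unfold apEx
      rw [if_neg (by omega), if_neg (by omega)]
    rw [hE', alphaS_one a b c d ap (show k + 1 ≤ r by omega), alphaS_one a b c d ap (show k ≤ r by omega), psum_cast, psum_cast,
      Finset.sum_range_succ, Finset.sum_range_succ]
    unfold L1
    generalize ∑ i ∈ Finset.range k, ap (i + 2) = P
    generalize ∑ i ∈ Finset.range k, (n (i + 1) : ℂ) = N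
    push_cast
    congr 1
    congr 1
    · congr 1
      · congr 1
        · congr 2; ring
        · congr 1; ring
      · congr 1; ring
    · congr 1; ring
  rw [pow_succ, ← hprod, hE, alphaS_last, alphaS_one a b c d ap le_rfl, alphaS_two a b c d ap le_rfl, psum_cast n (r + 1),
    psum_cast n r, Finset.sum_range_succ]
  unfold HH KK
  generalize ∑ i ∈ Finset.range r, ap (i + 2) = P
  generalize ∑ i ∈ Finset.range r, (n (i + 1) : ℂ) = N
  generalize n (r + 1) = k
  rw [show N + k + N + (a + b + 2 * P + (c + d)) - 1 = k + (a + P + N + (b + P + N) + c + d) - 1 by ring,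
    show N + k + N + (a + b + 2 * P) = a + P + N + (b + P + N) + k by ring,
    show (k : ℂ) + 2 * ((c + d) / 2) = c + d + k by ring,
    show 2 * (N + k) + (a + b + 2 * P + (c + d)) = a + P + N + (b + P + N) + c + d + 2 * k by ring,
    show a + c + P + (N + k) = a + P + N + c + k by ring,
    show a + d + P + (N + k) = a + P + N + d + k by ring,
    show b + c + P + (N + k) = b + P + N + c + k by ring,
    show b + d + P + (N + k) = b + P + N + d + k by ring]
  push_cast
  ring

lemma lift_succ (s : ℕ) (y : Fin s → ℝ) : (fun k => _root_.lift s y (k + 1)) = ext0 s y := by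
  ext k
  simp only [_root_.lift, ext0, Nat.add_sub_cancel]
end part10

/-- Tratnik's orthogonality relation (1.4) for the multivariable Wilson polynomials. -/
theorem mvWilson_orthogonality (s : ℕ) (hs : 1 ≤ s) (a b c d : ℂ) (ap : ℕ → ℂ)
    (ha : 0 < a.re) (hb : 0 < b.re) (hc : 0 < c.re) (hd : 0 < d.re)
    (hap : ∀ k, 2 ≤ k → k ≤ s → 0 < (ap k).re)
    (n m : ℕ → ℕ) :
    (∫ y : Fin s → ℝ,
        mvWilson a b c d ap s n (lift s y) * mvWilson a b c d ap s m (lift s y) *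
          wilsonRho a b c d ap s (lift s y)) =
      if ∀ k ∈ Finset.Icc 1 s, n k = m k then lamW a b c d ap s n else 0 := by
  obtain ⟨r, rfl⟩ : ∃ r, s = r + 1 := ⟨s - 1, by omega⟩
  have key := main_int hc hd r (p := fun k => ap (k + 2)) (fun k => n (k + 1)) (fun k => m (k + 1)) ha hb
    (fun k hk => hap _ (by omega) (by omega))
  have h1 : ∀ y, _root_.lift (r + 1) y 1 = ext0 (r + 1) y 0 := fun y => congrFun (lift_succ (r + 1) y) 0
  simp only [mvWilson_eq, wilsonRho_eq, lamW_eq, lift_succ, h1]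
  have hiff : (∀ k ∈ Finset.Icc 1 (r + 1), n k = m k) ↔ ∀ k < r + 1, n (k + 1) = m (k + 1) := by
    constructor
    · intro H k hk
      exact H _ (Finset.mem_Icc.2 ⟨by omega, by omega⟩)
    · intro H k hk
      have := Finset.mem_Icc.1 hk
      obtain ⟨j, rfl⟩ : ∃ j, k = j + 1 := ⟨k - 1, by omega⟩
      exact H j (by omega)
  simp only [hiff]
  exact key
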